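/- arXiv:1508.00827 — 2 statements merged into one kernel-verified Lean document; each statement's English description precedes it below -/
import Mathlib

section
/- Let s ≤ −1/2 and let ε > 0. Then there exist a time T ∈ (0, ε) and a smooth function u : ℝ × ℝ → ℂ which is 1-periodic in the first variable (u(x+1,t) = u(x,t) for all x, t), satisfies the defocusing cubic nonlinear Schrödinger equation i ∂_t u(x,t) − ∂_x² u(x,t) + |u(x,t)|² u(x,t) = 0 for all (x,t) ∈ ℝ × ℝ, and satisfies ‖u(·,0)‖_{H^s(𝕋)} < ε and ‖u(·,T)‖_{H^s(𝕋)} > ε^{−1}. -/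
open scoped Real

/-- Fourier coefficient of a 1-periodic function `f : ℝ → ℂ`:
`f̂(n) = ∫₀¹ f(x) e^{−2πinx} dx`. -/
noncomputable def fourierCoeff1 (f : ℝ → ℂ) (n : ℤ) : ℂ :=
  ∫ x in (0:ℝ)..1, f x * Complex.exp (-2 * (π : ℂ) * Complex.I * (n : ℂ) * (x : ℂ))

/-- Sobolev `H^s(𝕋)` norm: `‖f‖ = (Σ_{n∈ℤ} (1+n²)^s |f̂(n)|²)^{1/2}`. -/
noncomputable def HsNormT (s : ℝ) (f : ℝ → ℂ) : ℝ :=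
  Real.sqrt (∑' n : ℤ, ((1:ℝ) + (n:ℝ)^2) ^ s * ‖fourierCoeff1 f n‖^2)



namespace NLS

/-! ### The space `ℓ¹(ℤ)` and its operations -/

/-- Summable complex sequences indexed by `ℤ`. -/
noncomputable abbrev L1 : Type := lp (fun _ : ℤ => ℂ) 1

theorem summable_norm (a : L1) : Summable (fun n => ‖a n‖) := by
  have := lp.hasSum_norm (p := 1) (by simp) a
  simpa using this.summable

theorem norm_eq (a : L1) : ‖a‖ = ∑' n, ‖a n‖ := by
  have := lp.norm_eq_tsum_rpow (p := 1) (by simp) a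
  simpa using this

/-- Build an element of `ℓ¹`. -/
def mk (f : ℤ → ℂ) (hf : Summable (fun n => ‖f n‖)) : L1 :=
  ⟨f, by
    apply memℓp_gen
    simpa using hf⟩

@[simp] theorem mk_apply (f : ℤ → ℂ) (hf) (n : ℤ) : mk f hf n = f n := rfl

theorem norm_mk (f : ℤ → ℂ) (hf) : ‖mk f hf‖ = ∑' n, ‖f n‖ := norm_eq _

theorem apply_le (a : L1) (n : ℤ) : ‖a n‖ ≤ ‖a‖ := lp.norm_apply_le_norm (by simp) a n

theorem diag_summable (m : ℤ → ℂ) (B : ℝ) (hm : ∀ n, ‖m n‖ ≤ B) (a : L1) :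
    Summable (fun n => ‖m n * a n‖) := by
  refine Summable.of_nonneg_of_le (fun n => norm_nonneg _) (fun n => ?_)
    ((summable_norm a).mul_left B)
  rw [norm_mul]
  gcongr
  exact hm n

/-- Diagonal operator with bounded symbol. -/
noncomputable def diag (m : ℤ → ℂ) (B : ℝ) (hm : ∀ n, ‖m n‖ ≤ B) : L1 →L[ℂ] L1 :=
  LinearMap.mkContinuous
    { toFun := fun a => mk (fun n => m n * a n) (diag_summable m B hm a)
      map_add' := fun a b => by
        ext n
        change m n * (a n + b n) = m n * a n + m n * b n
        ring
      map_smul' := fun c a => by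
        ext n
        change m n * (c * a n) = c * (m n * a n)
        ring } B (fun a => by
        change ‖mk _ (diag_summable m B hm a)‖ ≤ _
        rw [norm_mk, norm_eq, ← tsum_mul_left]
        have h : ∀ n, ‖m n * a n‖ ≤ B * ‖a n‖ := fun n => by
          rw [norm_mul]
          gcongr
          exact hm n
        exact Summable.tsum_le_tsum h (diag_summable m B hm a) ((summable_norm a).mul_left B))

@[simp] theorem diag_apply (m : ℤ → ℂ) (B hm) (a : L1) (n : ℤ) :
    diag m B hm a n = m n * a n := rfl

theorem shift_summable (p : ℤ) (a : L1) : Summable (fun n => ‖a (n - p)‖) :=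
  (Equiv.subRight p).summable_iff.mpr (summable_norm a)

/-- Translation of a sequence. -/
noncomputable def shift (p : ℤ) : L1 →L[ℂ] L1 :=
  LinearMap.mkContinuous
    { toFun := fun a => mk (fun n => a (n - p)) (shift_summable p a)
      map_add' := fun a b => rfl
      map_smul' := fun c a => rfl } 1 (fun a => by
        change ‖mk _ (shift_summable p a)‖ ≤ _
        rw [norm_mk, norm_eq, one_mul]
        exact ((Equiv.subRight p).tsum_eq (fun n => ‖a n‖)).le)

@[simp] theorem shift_apply (p : ℤ) (a : L1) (n : ℤ) : shift p a n = a (n - p) := rfl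

theorem norm_shift (p : ℤ) (a : L1) : ‖shift p a‖ = ‖a‖ := by
  rw [norm_eq, norm_eq]
  exact (Equiv.subRight p).tsum_eq (fun n => ‖a n‖)

/-- Sequence of the conjugate function. -/
noncomputable def cj (a : L1) : L1 :=
  mk (fun n => starRingEnd ℂ (a (-n))) (by
    simp only [RCLike.norm_conj]
    exact (Equiv.neg ℤ).summable_iff.mpr (summable_norm a))

@[simp] theorem cj_apply (a : L1) (n : ℤ) : cj a n = starRingEnd ℂ (a (-n)) := rfl

theorem norm_cj (a : L1) : ‖cj a‖ = ‖a‖ := by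
  rw [norm_eq, norm_eq]
  simp only [cj_apply, RCLike.norm_conj]
  exact (Equiv.neg ℤ).tsum_eq (fun n => ‖a n‖)

theorem cj_sub (a b : L1) : cj (a - b) = cj a - cj b := by
  ext n
  simp

theorem summable_conv (a b : L1) : Summable (fun p => ‖a p • shift p b‖) := by
  simp only [norm_smul, norm_shift]
  exact (summable_norm a).mul_right _

/-- Convolution. -/
noncomputable def conv (a b : L1) : L1 := ∑' p, a p • shift p b

theorem summable_conv' (a b : L1) : Summable (fun p => a p • shift p b) :=
  (summable_conv a b).of_norm

theorem map_conv {F : Type*} [NormedAddCommGroup F] [NormedSpace ℂ F] (l : L1 →L[ℂ] F) (a b : L1) :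
    l (conv a b) = ∑' p, a p • l (shift p b) := by
  rw [conv, l.map_tsum (summable_conv' a b)]
  simp

theorem conv_apply (a b : L1) (n : ℤ) : conv a b n = ∑' p, a p * b (n - p) := by
  have := map_conv (lp.evalCLM ℂ (fun _ : ℤ => ℂ) 1 n) a b
  simpa [lp.evalCLM] using this

theorem norm_conv_le (a b : L1) : ‖conv a b‖ ≤ ‖a‖ * ‖b‖ := by
  refine (norm_tsum_le_tsum_norm (summable_conv a b)).trans ?_
  simp only [norm_smul, norm_shift]
  rw [tsum_mul_right, norm_eq a]

theorem conv_sub_right (a b c : L1) : conv a (b - c) = conv a b - conv a c := by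
  unfold conv
  rw [← (summable_conv' a b).tsum_sub (summable_conv' a c)]
  simp [smul_sub]

theorem conv_sub_left (a b c : L1) : conv (a - b) c = conv a c - conv b c := by
  unfold conv
  rw [← (summable_conv' a c).tsum_sub (summable_conv' b c)]
  simp [sub_smul]

theorem conv_smul_left (r : ℝ) (a c : L1) : conv (r • a) c = r • conv a c := by
  unfold conv
  rw [← (summable_conv' a c).tsum_const_smul r]
  congr 1
  ext p : 1
  ext n
  simp
  ring

theorem conv_smul_right (r : ℝ) (a c : L1) : conv a (r • c) = r • conv a c := by
  unfold conv
  rw [← (summable_conv' a c).tsum_const_smul r]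
  congr 1
  ext p : 1
  ext n
  simp
  ring

theorem cj_smul (r : ℝ) (a : L1) : cj (r • a) = r • cj a := by
  ext n
  simp

/-- The cubic nonlinearity. -/
noncomputable def cub (a : L1) : L1 := conv (conv a a) (cj a)

theorem cub_smul (r : ℝ) (a : L1) : cub (r • a) = r ^ 3 • cub a := by
  unfold cub
  rw [cj_smul, conv_smul_right, conv_smul_right, conv_smul_left, conv_smul_left, smul_smul,
    conv_smul_left, smul_smul]
  ring_nf

theorem norm_cub_le (a : L1) : ‖cub a‖ ≤ ‖a‖ ^ 3 := by
  unfold cub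
  calc _ ≤ ‖conv a a‖ * ‖cj a‖ := norm_conv_le _ _
    _ ≤ (‖a‖ * ‖a‖) * ‖a‖ := by
      rw [norm_cj]
      gcongr
      exact norm_conv_le _ _
    _ = _ := by ring

theorem cub_sub (c a : L1) : cub c - cub a = conv (conv (c - a) c) (cj c) +
    conv (conv a (c - a)) (cj c) + conv (conv a a) (cj (c - a)) := by
  unfold cub
  simp only [conv_sub_left, conv_sub_right, cj_sub]
  abel

theorem norm_cub_sub_le (c a : L1) (K : ℝ) (hc : ‖c‖ ≤ K) (ha : ‖a‖ ≤ K) :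
    ‖cub c - cub a‖ ≤ 3 * K ^ 2 * ‖c - a‖ := by
  have hK : 0 ≤ K := (norm_nonneg _).trans hc
  have key : ∀ x y z : L1, ‖conv (conv x y) z‖ ≤ ‖x‖ * ‖y‖ * ‖z‖ := fun x y z =>
    (norm_conv_le _ _).trans (by gcongr; exact norm_conv_le _ _)
  rw [cub_sub]
  calc _ ≤ ‖c - a‖ * ‖c‖ * ‖c‖ + ‖a‖ * ‖c - a‖ * ‖c‖ + ‖a‖ * ‖a‖ * ‖c - a‖ := by
        refine (norm_add₃_le).trans ?_
        have h1 := key (c - a) c (cj c)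
        have h2 := key a (c - a) (cj c)
        have h3 := key a a (cj (c - a))
        simp only [norm_cj] at h1 h2 h3
        linarith
    _ ≤ ‖c - a‖ * K * K + K * ‖c - a‖ * K + K * K * ‖c - a‖ := by gcongr
    _ = _ := by ring

/-! sup-norm estimates -/

theorem conv_sup_right (a b : L1) (B : ℝ) (hb : ∀ n, ‖b n‖ ≤ B) (n : ℤ) :
    ‖conv a b n‖ ≤ ‖a‖ * B := by
  rw [conv_apply, norm_eq, ← tsum_mul_right]
  have h : ∀ p, ‖a p * b (n - p)‖ ≤ ‖a p‖ * B := fun p => by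
    rw [norm_mul]
    gcongr
    exact hb _
  have hs := (summable_norm a).mul_right B
  have hs' := Summable.of_nonneg_of_le (fun n => norm_nonneg _) h hs
  exact (norm_tsum_le_tsum_norm hs').trans (Summable.tsum_le_tsum h hs' hs)

theorem conv_sup_left (a b : L1) (B : ℝ) (ha : ∀ n, ‖a n‖ ≤ B) (n : ℤ) :
    ‖conv a b n‖ ≤ B * ‖b‖ := by
  rw [conv_apply, norm_eq, ← tsum_mul_left]
  have h : ∀ p, ‖a p * b (n - p)‖ ≤ B * ‖b (n - p)‖ := fun p => by
    rw [norm_mul]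
    gcongr
    exact ha _
  have hs : Summable (fun p => B * ‖b (n - p)‖) :=
    ((Equiv.subLeft n).summable_iff.mpr (summable_norm b)).mul_left B
  have hs' := Summable.of_nonneg_of_le (fun n => norm_nonneg _) h hs
  refine (norm_tsum_le_tsum_norm hs').trans ((Summable.tsum_le_tsum h hs' hs).trans ?_)
  exact ((Equiv.subLeft n).tsum_eq (fun p => B * ‖b p‖)).le

theorem cub_sup (a : L1) (B : ℝ) (ha : ∀ n, ‖a n‖ ≤ B) (n : ℤ) :
    ‖cub a n‖ ≤ ‖a‖ ^ 2 * B := by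
  have hB : 0 ≤ B := (norm_nonneg _).trans (ha 0)
  unfold cub
  refine (conv_sup_right _ _ B (fun n => by simpa using ha (-n)) n).trans ?_
  gcongr
  rw [sq]
  exact norm_conv_le _ _

theorem cub_sub_sup (c a : L1) (K D : ℝ) (hc : ‖c‖ ≤ K) (ha : ‖a‖ ≤ K)
    (h : ∀ n, ‖c n - a n‖ ≤ D) (n : ℤ) :
    ‖cub c n - cub a n‖ ≤ 3 * K ^ 2 * D := by
  have hK : 0 ≤ K := (norm_nonneg _).trans hc
  have hD : 0 ≤ D := (norm_nonneg _).trans (h 0)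
  have e : cub c n - cub a n = conv (conv (c - a) c) (cj c) n +
    conv (conv a (c - a)) (cj c) n + conv (conv a a) (cj (c - a)) n := by
    have := congrArg (fun z : L1 => z n) (cub_sub c a)
    simpa using this
  have hd : ∀ n, ‖(c - a) n‖ ≤ D := fun n => by simpa using h n
  have h1 := conv_sup_left (conv (c - a) c) (cj c) _ (conv_sup_left (c - a) c D hd) n
  have h2 := conv_sup_left (conv a (c - a)) (cj c) _ (conv_sup_right a (c - a) D hd) n
  have h3 := conv_sup_right (conv a a) (cj (c - a)) D (fun n => by
    rw [cj_apply, RCLike.norm_conj]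
    exact hd (-n)) n
  have h4 := norm_conv_le a a
  rw [norm_cj] at h1 h2
  rw [e]
  calc _ ≤ D * ‖c‖ * ‖c‖ + ‖a‖ * D * ‖c‖ + ‖a‖ * ‖a‖ * D := by
        refine (norm_add₃_le).trans ?_
        gcongr
        exact h3.trans (by gcongr)
    _ ≤ D * K * K + K * D * K + K * K * D := by gcongr
    _ = _ := by ring

/-! Weighted estimates -/

theorem weighted_conv (w : ℤ → ℂ) (B : ℝ) (hw : ∀ n, ‖w n‖ ≤ B) (C : ℝ)
    (hC : ∀ m n, ‖w (m + n)‖ ≤ C * (‖w m‖ + ‖w n‖)) (hC0 : 0 ≤ C) (a b : L1) :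
    ‖diag w B hw (conv a b)‖ ≤ C * (‖diag w B hw a‖ * ‖b‖ + ‖a‖ * ‖diag w B hw b‖) := by
  have hsh : ∀ p, ‖diag w B hw (shift p b)‖ ≤ C * (‖w p‖ * ‖b‖ + ‖diag w B hw b‖) := by
    intro p
    have e1 : ‖diag w B hw (shift p b)‖ = ∑' n, ‖w (n + p)‖ * ‖b n‖ := by
      rw [norm_eq, ← (Equiv.addRight p).tsum_eq]
      simp
    rw [e1, norm_eq b, norm_eq (diag w B hw b), ← tsum_mul_left]
    have s1 := (summable_norm b).mul_left ‖w p‖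
    have s2 := (summable_norm (diag w B hw b))
    rw [← s1.tsum_add s2, ← tsum_mul_left]
    have h : ∀ n, ‖w (n + p)‖ * ‖b n‖ ≤ C * (‖w p‖ * ‖b n‖ + ‖diag w B hw b n‖) := by
      intro n
      calc _ ≤ C * (‖w n‖ + ‖w p‖) * ‖b n‖ := by
            gcongr
            exact hC n p
        _ = _ := by
            simp only [diag_apply, norm_mul]
            ring
    exact Summable.tsum_le_tsum h (Summable.of_nonneg_of_le (fun n => by positivity) h
      ((s1.add s2).mul_left C)) ((s1.add s2).mul_left C)
  rw [map_conv]
  have s1 := (summable_norm (diag w B hw a)).mul_right ‖b‖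
  have s2 := (summable_norm a).mul_right ‖diag w B hw b‖
  have h : ∀ p, ‖a p • diag w B hw (shift p b)‖ ≤
      C * (‖diag w B hw a p‖ * ‖b‖ + ‖a p‖ * ‖diag w B hw b‖) := by
    intro p
    rw [norm_smul]
    calc _ ≤ ‖a p‖ * (C * (‖w p‖ * ‖b‖ + ‖diag w B hw b‖)) := by
          gcongr
          exact hsh p
      _ = _ := by
          simp only [diag_apply, norm_mul]
          ring
  have hs' := Summable.of_nonneg_of_le (fun n => norm_nonneg _) h ((s1.add s2).mul_left C)
  refine (norm_tsum_le_tsum_norm hs').trans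
    ((Summable.tsum_le_tsum h hs' ((s1.add s2).mul_left C)).trans ?_)
  rw [tsum_mul_left, s1.tsum_add s2, tsum_mul_right, tsum_mul_right, ← norm_eq, ← norm_eq]

theorem weighted_cj (w : ℤ → ℂ) (B : ℝ) (hw : ∀ n, ‖w n‖ ≤ B) (hev : ∀ n, ‖w (-n)‖ = ‖w n‖)
    (a : L1) : ‖diag w B hw (cj a)‖ = ‖diag w B hw a‖ := by
  rw [norm_eq, norm_eq, ← (Equiv.neg ℤ).tsum_eq]
  simp [hev]

theorem weighted_cub (w : ℤ → ℂ) (B : ℝ) (hw : ∀ n, ‖w n‖ ≤ B) (hev : ∀ n, ‖w (-n)‖ = ‖w n‖)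
    (C : ℝ) (hC : ∀ m n, ‖w (m + n)‖ ≤ C * (‖w m‖ + ‖w n‖)) (hC1 : 1 ≤ C) (a : L1) :
    ‖diag w B hw (cub a)‖ ≤ 3 * C ^ 2 * ‖a‖ ^ 2 * ‖diag w B hw a‖ := by
  have hC0 : 0 ≤ C := by linarith
  unfold cub
  have h1 := weighted_conv w B hw C hC hC0 a a
  have h2 := weighted_conv w B hw C hC hC0 (conv a a) (cj a)
  rw [weighted_cj w B hw hev, norm_cj] at h2
  have h3 := norm_conv_le a a
  have h0 := norm_nonneg (diag w B hw a)
  calc _ ≤ _ := h2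
    _ ≤ C * ((C * (‖diag w B hw a‖ * ‖a‖ + ‖a‖ * ‖diag w B hw a‖)) * ‖a‖
        + (‖a‖ * ‖a‖) * ‖diag w B hw a‖) := by gcongr
    _ = (2 * C ^ 2 + C) * (‖a‖ ^ 2 * ‖diag w B hw a‖) := by ring
    _ ≤ (3 * C ^ 2) * (‖a‖ ^ 2 * ‖diag w B hw a‖) := by
        gcongr
        nlinarith
    _ = _ := by ring

/-- Truncated polynomial weight. -/
noncomputable def wt (k : ℕ) (R : ℝ) (n : ℤ) : ℂ := ((min ((1 + |(n : ℝ)|) ^ k) (max R 0) : ℝ) : ℂ)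

theorem norm_wt (k : ℕ) (R : ℝ) (n : ℤ) :
    ‖wt k R n‖ = min ((1 + |(n : ℝ)|) ^ k) (max R 0) := by
  rw [wt, Complex.norm_real, Real.norm_of_nonneg]
  positivity

theorem wt_le (k : ℕ) (R : ℝ) (n : ℤ) : ‖wt k R n‖ ≤ max R 0 := by
  rw [norm_wt]
  exact min_le_right _ _

theorem wt_even (k : ℕ) (R : ℝ) (n : ℤ) : ‖wt k R (-n)‖ = ‖wt k R n‖ := by
  simp [norm_wt]

theorem wt_add (k : ℕ) (R : ℝ) (m n : ℤ) :
    ‖wt k R (m + n)‖ ≤ 2 ^ k * (‖wt k R m‖ + ‖wt k R n‖) := by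
  simp only [norm_wt]
  push_cast
  have hR : 0 ≤ max R 0 := le_max_right _ _
  generalize max R 0 = R at hR
  have main : ∀ x y : ℝ, |y| ≤ |x| →
      min ((1 + |x + y|) ^ k) R ≤ 2 ^ k * min ((1 + |x|) ^ k) R := by
    intro x y h
    have h1 : (1 + |x + y|) ^ k ≤ 2 ^ k * (1 + |x|) ^ k := by
      rw [← mul_pow]
      gcongr
      have := abs_add_le x y
      linarith [abs_nonneg x]
    have h2 : R ≤ 2 ^ k * R := le_mul_of_one_le_left hR (one_le_pow₀ (by norm_num))
    rw [mul_min_of_nonneg _ _ (by positivity)]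
    exact min_le_min h1 h2
  rcases le_total |(n : ℝ)| |(m : ℝ)| with h | h
  · refine (main _ _ h).trans ?_
    have : 0 ≤ min ((1 + |(n : ℝ)|) ^ k) R := by positivity
    have : 0 ≤ min ((1 + |(m : ℝ)|) ^ k) R := by positivity
    gcongr
    linarith
  · rw [add_comm (m : ℝ)]
    refine (main _ _ h).trans ?_
    have : 0 ≤ min ((1 + |(n : ℝ)|) ^ k) R := by positivity
    have : 0 ≤ min ((1 + |(m : ℝ)|) ^ k) R := by positivity
    gcongr
    linarith

end NLS

namespace NLS

/-! ### Characters and evaluation -/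

/-- The character `e^{2 π i n x}`. -/
noncomputable def e (n : ℤ) (x : ℝ) : ℂ := Complex.exp (2 * π * Complex.I * n * x)

theorem norm_e (n : ℤ) (x : ℝ) : ‖e n x‖ = 1 := by
  rw [e, show (2 * π * Complex.I * n * x : ℂ) = ((2 * π * n * x : ℝ) : ℂ) * Complex.I by
    push_cast; ring]
  exact Complex.norm_exp_ofReal_mul_I _

theorem e_add (m n : ℤ) (x : ℝ) : e (m + n) x = e m x * e n x := by
  rw [e, e, e, ← Complex.exp_add]
  congr 1
  push_cast
  ring

theorem e_neg (n : ℤ) (x : ℝ) : e (-n) x = starRingEnd ℂ (e n x) := by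
  rw [e, e, ← Complex.exp_conj]
  congr 1
  simp [Complex.conj_ofNat]

theorem ev_summable (a : L1) (x : ℝ) : Summable (fun n => a n * e n x) := by
  apply Summable.of_norm
  simp only [norm_mul, norm_e, mul_one]
  exact summable_norm a

/-- Evaluation of the Fourier series at a point. -/
noncomputable def ev (x : ℝ) : L1 →L[ℂ] ℂ :=
  LinearMap.mkContinuous
    { toFun := fun a => ∑' n, a n * e n x
      map_add' := fun a b => by
        rw [← (ev_summable a x).tsum_add (ev_summable b x)]
        congr 1
        ext n
        change (a n + b n) * _ = _
        ring
      map_smul' := fun c a => by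
        change ∑' n, (c * a n) * e n x = c * _
        rw [← tsum_mul_left]
        congr 1
        ext n
        ring } 1 (fun a => by
        change ‖∑' n, a n * e n x‖ ≤ _
        have h : ∀ n, ‖a n * e n x‖ = ‖a n‖ := fun n => by rw [norm_mul, norm_e, mul_one]
        refine (norm_tsum_le_tsum_norm (ev_summable a x).norm).trans ?_
        simp only [h, one_mul, norm_eq]
        exact le_rfl)

theorem ev_apply (a : L1) (x : ℝ) : ev x a = ∑' n, a n * e n x := rfl

theorem ev_shift (p : ℤ) (b : L1) (x : ℝ) : ev x (shift p b) = e p x * ev x b := by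
  rw [ev_apply, ev_apply, ← (Equiv.addRight p).tsum_eq, ← tsum_mul_left]
  congr 1
  ext n
  simp [e_add]
  ring

theorem ev_conv (a b : L1) (x : ℝ) : ev x (conv a b) = ev x a * ev x b := by
  rw [map_conv, ev_apply a, ← tsum_mul_right]
  congr 1
  ext p
  rw [ev_shift, smul_eq_mul]
  ring

theorem ev_cj (a : L1) (x : ℝ) : ev x (cj a) = starRingEnd ℂ (ev x a) := by
  rw [ev_apply, ev_apply, Complex.conj_tsum, ← (Equiv.neg ℤ).tsum_eq]
  congr 1
  ext n
  simp [e_neg]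

theorem ev_cub (a : L1) (x : ℝ) : ev x (cub a) = (‖ev x a‖ : ℂ) ^ 2 * ev x a := by
  rw [cub, ev_conv, ev_conv, ev_cj, mul_assoc, Complex.mul_conj, Complex.normSq_eq_norm_sq]
  push_cast
  ring

/-! ### The propagator -/

/-- The phase of the free Schrödinger evolution. -/
noncomputable def ph (n : ℤ) (t : ℝ) : ℂ := Complex.exp (((4 * π ^ 2 * n ^ 2 * t : ℝ) : ℂ) * Complex.I)

theorem norm_ph (n : ℤ) (t : ℝ) : ‖ph n t‖ = 1 := Complex.norm_exp_ofReal_mul_I _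

theorem ph_mul_neg (n : ℤ) (t : ℝ) : ph n t * ph n (-t) = 1 := by
  rw [ph, ph, ← Complex.exp_add]
  simp

theorem ph_zero (n : ℤ) : ph n 0 = 1 := by simp [ph]

theorem continuous_ph (n : ℤ) : Continuous (ph n) := by
  unfold ph
  fun_prop

theorem hasDerivAt_ph (n : ℤ) (t : ℝ) :
    HasDerivAt (ph n) (Complex.I * (4 * π ^ 2 * n ^ 2) * ph n t) t := by
  have h1 : HasDerivAt (fun t : ℝ => 4 * π ^ 2 * (n : ℝ) ^ 2 * t) (4 * π ^ 2 * (n : ℝ) ^ 2) t := by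
    simpa using (hasDerivAt_id t).const_mul (4 * π ^ 2 * (n : ℝ) ^ 2)
  have h2 := (h1.ofReal_comp.mul_const Complex.I).cexp
  convert! h2 using 1
  rw [ph]
  push_cast
  ring

/-- The free Schrödinger evolution. -/
noncomputable def S (t : ℝ) : L1 →L[ℂ] L1 := diag (fun n => ph n t) 1 (fun n => (norm_ph n t).le)

@[simp] theorem S_apply (t : ℝ) (a : L1) (n : ℤ) : S t a n = ph n t * a n := rfl

theorem norm_S (t : ℝ) (a : L1) : ‖S t a‖ = ‖a‖ := by
  rw [norm_eq, norm_eq]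
  simp [norm_ph]

theorem continuous_S (a : L1) : Continuous (fun t => S t a) := by
  rw [continuous_iff_continuousAt]
  intro s
  rw [ContinuousAt, tendsto_iff_norm_sub_tendsto_zero]
  have h : Continuous (fun t => ∑' n, ‖(ph n t - ph n s) * a n‖) := by
    refine continuous_tsum (u := fun n => 2 * ‖a n‖) (fun n => ?_) ((summable_norm a).mul_left 2)
      (fun n t => ?_)
    · have := continuous_ph n
      fun_prop
    · rw [norm_norm, norm_mul]
      gcongr
      refine (norm_sub_le _ _).trans ?_
      rw [norm_ph, norm_ph]
      norm_num
  have h2 : ∀ t, ‖S t a - S s a‖ = ∑' n, ‖(ph n t - ph n s) * a n‖ := by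
    intro t
    rw [norm_eq]
    congr 1
    ext n
    simp [sub_mul]
  simp only [h2]
  have := h.tendsto s
  simpa using this

theorem continuous_S_comp {v : ℝ → L1} {f : ℝ → ℝ} (hf : Continuous f) (hv : Continuous v) :
    Continuous (fun t => S (f t) (v t)) := by
  rw [continuous_iff_continuousAt]
  intro s
  rw [ContinuousAt, tendsto_iff_norm_sub_tendsto_zero]
  have h1 : Continuous (fun t => ‖v t - v s‖ + ‖S (f t) (v s) - S (f s) (v s)‖) := by
    have := (continuous_S (v s)).comp hf
    simp only [Function.comp_def] at this
    fun_prop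
  have h2 := h1.tendsto s
  simp only [sub_self, norm_zero, add_zero] at h2
  refine squeeze_zero (fun t => norm_nonneg _) (fun t => ?_) h2
  calc _ = ‖S (f t) (v t - v s) + (S (f t) (v s) - S (f s) (v s))‖ := by
        rw [map_sub]
        congr 1
        abel
    _ ≤ _ := by
        refine (norm_add_le _ _).trans ?_
        rw [norm_S]

theorem continuous_cub : Continuous cub := by
  rw [continuous_iff_continuousAt]
  intro a
  rw [ContinuousAt, tendsto_iff_norm_sub_tendsto_zero]
  have h : Continuous (fun c : L1 => 3 * (‖c‖ + ‖a‖) ^ 2 * ‖c - a‖) := by fun_prop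
  have h2 := h.tendsto a
  simp only [sub_self, norm_zero, mul_zero] at h2
  refine squeeze_zero (fun t => norm_nonneg _) (fun c => ?_) h2
  exact norm_cub_sub_le c a _ (by linarith [norm_nonneg a]) (by linarith [norm_nonneg c])

/-! ### Global existence for bounded Lipschitz fields -/

theorem exists_global {E : Type*} [NormedAddCommGroup E] [NormedSpace ℝ E] [CompleteSpace E]
    (f : ℝ → E → E) (L K : NNReal) (hK : ∀ t, LipschitzWith K (f t))
    (hL : ∀ t x, ‖f t x‖ ≤ L) (hc : ∀ x, Continuous (fun t => f t x)) (a : E) :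
    ∃ v : ℝ → E, v 0 = a ∧ ∀ t, HasDerivAt v (f t (v t)) t := by
  have loc : ∀ n : ℕ, ∃ v : ℝ → E, v 0 = a ∧
      ∀ t ∈ Set.Ioo (-(n + 1 : ℝ)) (n + 1), HasDerivAt v (f t (v t)) t := by
    intro n
    have h0 : (0 : ℝ) ∈ Set.Icc (-(n + 1 : ℝ)) (n + 1) := by
      constructor <;> linarith [(Nat.cast_nonneg n : (0 : ℝ) ≤ n)]
    have hp : IsPicardLindelof f (⟨0, h0⟩ : Set.Icc (-(n + 1 : ℝ)) (n + 1)) a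
        (L * (n + 1)) 0 L K := by
      refine ⟨fun t _ => (hK t).lipschitzOnWith, fun x _ => (hc x).continuousOn,
        fun t _ x _ => hL t x, ?_⟩
      simp
    obtain ⟨v, hv0, hv⟩ := hp.exists_eq_forall_mem_Icc_hasDerivWithinAt₀
    refine ⟨v, hv0, fun t ht => ?_⟩
    exact (hv t (Set.Ioo_subset_Icc_self ht)).hasDerivAt (Icc_mem_nhds ht.1 ht.2)
  choose v hv0 hv using loc
  have uniq : ∀ m n : ℕ, m ≤ n → Set.EqOn (v m) (v n) (Set.Ioo (-(m + 1 : ℝ)) (m + 1)) := by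
    intro m n hmn
    have hmn' : (m : ℝ) ≤ n := by exact_mod_cast hmn
    refine ODE_solution_unique_of_mem_Ioo (v := f) (s := fun _ => Set.univ) (K := K) (t₀ := 0)
      (fun t _ => (hK t).lipschitzOnWith) ?_ (fun t ht => ⟨hv m t ht, trivial⟩)
      (fun t ht => ⟨hv n t ⟨by linarith [ht.1], by linarith [ht.2]⟩, trivial⟩) ?_
    · constructor <;> linarith [(Nat.cast_nonneg m : (0 : ℝ) ≤ m)]
    · rw [hv0, hv0]
  have key : ∀ m : ℕ, ∀ t ∈ Set.Ioo (-(m + 1 : ℝ)) (m + 1), v (⌈|t|⌉₊) t = v m t := by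
    intro m t ht
    have ht2 : t ∈ Set.Ioo (-((⌈|t|⌉₊ : ℕ) + 1 : ℝ)) ((⌈|t|⌉₊ : ℕ) + 1) := by
      have := Nat.le_ceil |t|
      constructor <;> linarith [neg_abs_le t, le_abs_self t]
    rcases le_total ⌈|t|⌉₊ m with h | h
    · exact uniq _ _ h ht2
    · exact (uniq _ _ h ht).symm
  refine ⟨fun t => v ⌈|t|⌉₊ t, hv0 _, fun t => ?_⟩
  obtain ⟨m, hm⟩ := exists_nat_gt |t|
  have ht : t ∈ Set.Ioo (-(m + 1 : ℝ)) (m + 1) := by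
    constructor <;> linarith [neg_abs_le t, le_abs_self t]
  have := hv m t ht
  simp only [key m t ht]
  refine this.congr_of_eventuallyEq ?_
  filter_upwards [isOpen_Ioo.mem_nhds ht] with s hs
  exact key m s hs

/-! ### The truncated flow -/

/-- Radial retraction scalar. -/
noncomputable def rt (K : ℝ) (v : L1) : ℝ := K / max K ‖v‖

theorem rt_nonneg {K : ℝ} (hK : 0 < K) (v : L1) : 0 ≤ rt K v := by
  unfold rt
  positivity

theorem rt_le_one {K : ℝ} (hK : 0 < K) (v : L1) : rt K v ≤ 1 := by
  unfold rt
  rw [div_le_one (by positivity)]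
  exact le_max_left _ _

theorem rt_eq_one {K : ℝ} (hK : 0 < K) {v : L1} (hv : ‖v‖ ≤ K) : rt K v = 1 := by
  unfold rt
  rw [max_eq_left hv, div_self hK.ne']

theorem norm_rt_le {K : ℝ} (hK : 0 < K) (v : L1) : ‖rt K v • v‖ ≤ K := by
  rw [norm_smul, Real.norm_of_nonneg (rt_nonneg hK v), rt, div_mul_eq_mul_div,
    div_le_iff₀ (by positivity)]
  gcongr
  exact le_max_right _ _

theorem rt_lip {K : ℝ} (hK : 0 < K) (x y : L1) :
    ‖rt K x • x - rt K y • y‖ ≤ 2 * ‖x - y‖ := by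
  have h1 : rt K x • x - rt K y • y = rt K x • (x - y) + (rt K x - rt K y) • y := by
    rw [smul_sub, sub_smul]
    abel
  have h2 : |rt K x - rt K y| * ‖y‖ ≤ ‖x - y‖ := by
    unfold rt
    have hx : 0 < max K ‖x‖ := by positivity
    have hy : 0 < max K ‖y‖ := by positivity
    have e1 : K / max K ‖x‖ - K / max K ‖y‖ =
        (K / max K ‖x‖) * ((max K ‖y‖ - max K ‖x‖) / max K ‖y‖) := by
      field_simp
    rw [e1, abs_mul, abs_of_nonneg (by positivity : 0 ≤ K / max K ‖x‖), abs_div, abs_of_pos hy]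
    have h3 : |max K ‖y‖ - max K ‖x‖| ≤ ‖x - y‖ := by
      rw [abs_sub_comm, max_comm K, max_comm K]
      exact (abs_max_sub_max_le_abs _ _ _).trans (abs_norm_sub_norm_le x y)
    calc _ ≤ 1 * (‖x - y‖ / max K ‖y‖) * max K ‖y‖ := by
          gcongr
          · rw [div_le_one hx]
            exact le_max_left _ _
          · exact le_max_right _ _
      _ = _ := by field_simp
  rw [h1]
  refine (norm_add_le _ _).trans ?_
  rw [norm_smul, norm_smul, Real.norm_of_nonneg (rt_nonneg hK x), Real.norm_eq_abs]
  have := mul_le_of_le_one_left (norm_nonneg (x - y)) (rt_le_one hK x)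
  linarith

/-- The truncated vector field in the interaction picture. -/
noncomputable def F (K t : ℝ) (v : L1) : L1 :=
  Complex.I • S (-t) (cub (S t (rt K v • v)))

theorem S_smul (t r : ℝ) (a : L1) : S t (r • a) = r • S t a := by
  ext n
  simp

theorem F_apply (K t : ℝ) (v : L1) (n : ℤ) :
    F K t v n = Complex.I * (ph n (-t) * ((rt K v ^ 3 : ℝ) * cub (S t v) n)) := by
  rw [F, S_smul, cub_smul]
  simp
  ring

theorem norm_F_le {K : ℝ} (hK : 0 < K) (t : ℝ) (v : L1) : ‖F K t v‖ ≤ K ^ 3 := by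
  rw [F, norm_smul, Complex.norm_I, one_mul, norm_S]
  refine (norm_cub_le _).trans ?_
  rw [norm_S]
  gcongr
  exact norm_rt_le hK v

theorem exists_flow {K : ℝ} (hK : 0 < K) (a : L1) :
    ∃ v : ℝ → L1, v 0 = a ∧ ∀ t, HasDerivAt v (F K t (v t)) t := by
  refine exists_global (F K) ⟨K ^ 3, by positivity⟩ ⟨6 * K ^ 2, by positivity⟩ ?_
    (fun t x => norm_F_le hK t x) ?_ a
  · intro t
    refine LipschitzWith.of_dist_le_mul fun x y => ?_
    rw [dist_eq_norm, dist_eq_norm, F, F, ← smul_sub, norm_smul, Complex.norm_I, one_mul, ← map_sub,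
      norm_S]
    refine (norm_cub_sub_le _ _ K (by rw [norm_S]; exact norm_rt_le hK x)
      (by rw [norm_S]; exact norm_rt_le hK y)).trans ?_
    rw [← map_sub, norm_S]
    change _ ≤ 6 * K ^ 2 * _
    nlinarith [rt_lip hK x y, sq_nonneg K]
  · intro x
    unfold F
    have h1 : Continuous (fun t => cub (S t (rt K x • x))) := continuous_cub.comp (continuous_S _)
    exact (continuous_S_comp continuous_neg h1).const_smul Complex.I

end NLS

namespace NLS

/-! ### Persistence of regularity -/

/-- Solutions of the truncated equation. -/
structure IsFlow (K : ℝ) (a : L1) (v : ℝ → L1) : Prop where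
  pos : 0 < K
  start : v 0 = a
  der : ∀ t, HasDerivAt v (F K t (v t)) t

/-- Truncated weight operator. -/
noncomputable def W (k : ℕ) (R : ℝ) : L1 →L[ℂ] L1 := diag (wt k R) (max R 0) (wt_le k R)

theorem W_apply (k : ℕ) (R : ℝ) (a : L1) (n : ℤ) : W k R a n = wt k R n * a n := rfl

theorem norm_W_S (k : ℕ) (R t : ℝ) (a : L1) : ‖W k R (S t a)‖ = ‖W k R a‖ := by
  rw [norm_eq, norm_eq]
  simp [W_apply, norm_ph]

theorem norm_W_cub (k : ℕ) (R : ℝ) (a : L1) :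
    ‖W k R (cub a)‖ ≤ 3 * (2 ^ k) ^ 2 * ‖a‖ ^ 2 * ‖W k R a‖ :=
  weighted_cub (wt k R) _ (wt_le k R) (wt_even k R) (2 ^ k) (wt_add k R)
    (one_le_pow₀ (by norm_num)) a

theorem norm_W_F (k : ℕ) (R : ℝ) {K : ℝ} (hK : 0 < K) (t : ℝ) (v : L1) :
    ‖W k R (F K t v)‖ ≤ 3 * (2 ^ k) ^ 2 * K ^ 2 * ‖W k R v‖ := by
  rw [F, map_smul, norm_smul, Complex.norm_I, one_mul, norm_W_S]
  refine (norm_W_cub _ _ _).trans ?_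
  rw [norm_S, norm_W_S]
  have h1 := norm_rt_le hK v
  have h2 : ‖W k R (rt K v • v)‖ ≤ ‖W k R v‖ := by
    have : W k R (rt K v • v) = rt K v • W k R v := by
      ext n
      simp [W_apply]
    rw [this, norm_smul, Real.norm_of_nonneg (rt_nonneg hK v)]
    exact mul_le_of_le_one_left (norm_nonneg _) (rt_le_one hK v)
  gcongr

theorem apply_le_W (k : ℕ) (a : L1) (C : ℝ) (h : ∀ R, ‖W k R a‖ ≤ C) (n : ℤ) :
    (1 + |(n : ℝ)|) ^ k * ‖a n‖ ≤ C := by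
  have h1 := (apply_le (W k ((1 + |(n : ℝ)|) ^ k) a) n).trans (h _)
  rw [W_apply, norm_mul, norm_wt, max_eq_left (by positivity), min_self] at h1
  exact h1

/-- Rapidly decaying sequences. -/
def Rapid (a : L1) : Prop := ∀ k : ℕ, ∃ C, ∀ R, ‖W k R a‖ ≤ C

theorem W_der {f : ℝ → L1} {f' : L1} {t : ℝ} (l : L1 →L[ℂ] L1) (h : HasDerivAt f f' t) :
    HasDerivAt (fun s => l (f s)) (l f') t :=
  (l.restrictScalars ℝ).hasFDerivAt.comp_hasDerivAt t h

theorem IsFlow.W_bound {K : ℝ} {a : L1} {v : ℝ → L1} (h : IsFlow K a v) (k : ℕ) (R t : ℝ) :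
    ‖W k R (v t)‖ ≤ ‖W k R a‖ * Real.exp (3 * (2 ^ k) ^ 2 * K ^ 2 * |t|) := by
  have d1 := fun t => W_der (W k R) (h.der t)
  rcases le_total 0 t with ht | ht
  · have := norm_le_gronwallBound_of_norm_deriv_right_le (f := fun s => W k R (v s))
      (f' := fun s => W k R (F K s (v s))) (δ := ‖W k R a‖) (K := 3 * (2 ^ k) ^ 2 * K ^ 2) (ε := 0)
      (a := 0) (b := t)
      (fun s _ => (d1 s).continuousAt.continuousWithinAt) (fun s _ => (d1 s).hasDerivWithinAt)
      (by rw [h.start]) (fun s _ => by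
        rw [add_zero]
        exact norm_W_F k R h.pos s (v s)) t ⟨ht, le_rfl⟩
    rw [gronwallBound_ε0, sub_zero] at this
    rw [abs_of_nonneg ht]
    exact this
  · have d2 : ∀ s : ℝ, HasDerivAt (fun s => W k R (v (-s))) (-(W k R (F K (-s) (v (-s))))) s := by
      intro s
      have := (d1 (-s)).scomp s (hasDerivAt_neg s)
      rw [neg_smul, one_smul] at this
      exact this
    have := norm_le_gronwallBound_of_norm_deriv_right_le (f := fun s => W k R (v (-s)))
      (f' := fun s => -(W k R (F K (-s) (v (-s))))) (δ := ‖W k R a‖)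
      (K := 3 * (2 ^ k) ^ 2 * K ^ 2) (ε := 0) (a := 0) (b := -t)
      (fun s _ => (d2 s).continuousAt.continuousWithinAt) (fun s _ => (d2 s).hasDerivWithinAt)
      (by simp [h.start]) (fun s _ => by
        rw [add_zero, norm_neg]
        exact norm_W_F k R h.pos (-s) (v (-s))) (-t) ⟨by linarith, le_rfl⟩
    rw [gronwallBound_ε0, sub_zero, neg_neg] at this
    rw [abs_of_nonpos ht]
    exact this

/-- Families of coefficients with rapid decay, locally uniformly in time. -/
def Dec (c : ℤ → ℝ → ℂ) : Prop :=
  ∀ (k : ℕ) (T : ℝ), ∃ C : ℝ, ∀ (n : ℤ) (t : ℝ), |t| ≤ T → (1 + |(n : ℝ)|) ^ k * ‖c n t‖ ≤ C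

theorem Dec.add {c d : ℤ → ℝ → ℂ} (hc : Dec c) (hd : Dec d) : Dec (fun n t => c n t + d n t) := by
  intro k T
  obtain ⟨C, hC⟩ := hc k T
  obtain ⟨D, hD⟩ := hd k T
  refine ⟨C + D, fun n t ht => ?_⟩
  calc _ ≤ (1 + |(n : ℝ)|) ^ k * (‖c n t‖ + ‖d n t‖) := by
        gcongr
        exact norm_add_le _ _
    _ ≤ _ := by
        rw [mul_add]
        exact add_le_add (hC n t ht) (hD n t ht)

theorem Dec.of_le {c d : ℤ → ℝ → ℂ} (hc : Dec c) (M : ℝ) (j : ℕ)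
    (h : ∀ n t, ‖d n t‖ ≤ M * (1 + |(n : ℝ)|) ^ j * ‖c n t‖) : Dec d := by
  intro k T
  obtain ⟨C, hC⟩ := hc (k + j) T
  refine ⟨|M| * C, fun n t ht => ?_⟩
  calc _ ≤ (1 + |(n : ℝ)|) ^ k * (M * (1 + |(n : ℝ)|) ^ j * ‖c n t‖) := by
        gcongr
        exact h n t
    _ = M * ((1 + |(n : ℝ)|) ^ (k + j) * ‖c n t‖) := by ring
    _ ≤ |M| * ((1 + |(n : ℝ)|) ^ (k + j) * ‖c n t‖) := by
        gcongr
        exact le_abs_self M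
    _ ≤ _ := by
        gcongr
        exact hC n t ht

/-- Fourier side `x`-derivative. -/
noncomputable def Dx (c : ℤ → ℝ → ℂ) (n : ℤ) (t : ℝ) : ℂ := (2 * π * Complex.I * n) * c n t

theorem Dec.Dx {c : ℤ → ℝ → ℂ} (hc : Dec c) : Dec (Dx c) := by
  refine hc.of_le (2 * π) 1 fun n t => ?_
  rw [NLS.Dx, norm_mul]
  gcongr
  simp only [norm_mul, Complex.norm_I, Complex.norm_real, Complex.norm_intCast]
  simp only [Complex.norm_ofNat, Real.norm_of_nonneg Real.pi_pos.le, mul_one, pow_one]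
  gcongr
  linarith

/-- The Fourier coefficients of the solution. -/
noncomputable def co (v : ℝ → L1) (n : ℤ) (t : ℝ) : ℂ := S t (v t) n

/-- The Fourier coefficients of the nonlinearity. -/
noncomputable def nl (v : ℝ → L1) (n : ℤ) (t : ℝ) : ℂ := cub (S t (v t)) n

/-- The time derivative of the Fourier coefficients. -/
noncomputable def dco (K : ℝ) (v : ℝ → L1) (n : ℤ) (t : ℝ) : ℂ :=
  Complex.I * (4 * π ^ 2 * n ^ 2) * co v n t + Complex.I * ((rt K (v t) ^ 3 : ℝ) * nl v n t)

theorem IsFlow.dec_co {K : ℝ} {a : L1} {v : ℝ → L1} (h : IsFlow K a v) (ha : Rapid a) :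
    Dec (co v) := by
  intro k T
  obtain ⟨C, hC⟩ := ha k
  refine ⟨C * Real.exp (3 * (2 ^ k) ^ 2 * K ^ 2 * T), fun n t ht => ?_⟩
  refine apply_le_W k _ _ (fun R => ?_) n
  rw [norm_W_S]
  have hC0 : 0 ≤ C := (norm_nonneg _).trans (hC 0)
  refine (h.W_bound k R t).trans ?_
  gcongr
  exact hC R

theorem IsFlow.cont {K : ℝ} {a : L1} {v : ℝ → L1} (h : IsFlow K a v) : Continuous v :=
  continuous_iff_continuousAt.mpr fun t => (h.der t).continuousAt

theorem IsFlow.norm_bound {K : ℝ} {a : L1} {v : ℝ → L1} (h : IsFlow K a v) (T : ℝ) :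
    ∃ B, ∀ t, |t| ≤ T → ‖v t‖ ≤ B := by
  obtain ⟨B, hB⟩ := (isCompact_Icc (a := -T) (b := T)).exists_bound_of_continuousOn
    h.cont.continuousOn
  exact ⟨B, fun t ht => hB t (abs_le.mp ht)⟩

theorem IsFlow.dec_nl {K : ℝ} {a : L1} {v : ℝ → L1} (h : IsFlow K a v) (ha : Rapid a) :
    Dec (nl v) := by
  intro k T
  obtain ⟨C, hC⟩ := ha k
  obtain ⟨B, hB⟩ := h.norm_bound T
  refine ⟨3 * (2 ^ k) ^ 2 * B ^ 2 * (C * Real.exp (3 * (2 ^ k) ^ 2 * K ^ 2 * T)),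
    fun n t ht => ?_⟩
  refine apply_le_W k _ _ (fun R => ?_) n
  refine (norm_W_cub _ _ _).trans ?_
  rw [norm_S, norm_W_S]
  have hC0 : 0 ≤ C := (norm_nonneg _).trans (hC 0)
  have h1 : ‖W k R (v t)‖ ≤ (C * Real.exp (3 * (2 ^ k) ^ 2 * K ^ 2 * T)) := by
    refine (h.W_bound k R t).trans ?_
    gcongr
    exact hC R
  have h2 := hB t ht
  gcongr

theorem IsFlow.dec_dco {K : ℝ} {a : L1} {v : ℝ → L1} (h : IsFlow K a v) (ha : Rapid a) :
    Dec (dco K v) := by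
  refine Dec.add ((h.dec_co ha).of_le (4 * π ^ 2) 2 fun n t => ?_)
    ((h.dec_nl ha).of_le 1 0 fun n t => ?_)
  · rw [norm_mul]
    gcongr
    simp only [norm_mul, Complex.norm_I, norm_pow, Complex.norm_real, Complex.norm_intCast,
      Complex.norm_ofNat, Real.norm_of_nonneg Real.pi_pos.le, one_mul]
    gcongr
    linarith
  · rw [norm_mul, norm_mul, Complex.norm_I, Complex.norm_real,
      Real.norm_of_nonneg (pow_nonneg (rt_nonneg h.pos _) _)]
    rw [one_mul, pow_zero, one_mul]
    refine mul_le_mul_of_nonneg_right ?_ (norm_nonneg _)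
    exact pow_le_one₀ (rt_nonneg h.pos _) (rt_le_one h.pos _)

theorem apply_der {f : ℝ → L1} {f' : L1} {t : ℝ} (n : ℤ) (h : HasDerivAt f f' t) :
    HasDerivAt (fun s => f s n) (f' n) t :=
  ((lp.evalCLM ℂ (fun _ : ℤ => ℂ) 1 n).restrictScalars ℝ).hasFDerivAt.comp_hasDerivAt t h

theorem apply_cont {f : ℝ → L1} (n : ℤ) (h : Continuous f) : Continuous (fun s => f s n) :=
  (lp.evalCLM ℂ (fun _ : ℤ => ℂ) 1 n).continuous.comp h

theorem IsFlow.der_co {K : ℝ} {a : L1} {v : ℝ → L1} (h : IsFlow K a v) (n : ℤ) (t : ℝ) :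
    HasDerivAt (co v n) (dco K v n t) t := by
  have h1 := (hasDerivAt_ph n t).mul (apply_der n (h.der t))
  have h2 : HasDerivAt (co v n) _ t := h1
  convert! h2 using 1
  rw [F_apply, dco, co, nl, S_apply]
  have := ph_mul_neg n t
  linear_combination (-(Complex.I * (((rt K (v t) ^ 3 : ℝ) : ℂ) * cub (S t (v t)) n))) * this

theorem IsFlow.cont_co {K : ℝ} {a : L1} {v : ℝ → L1} (h : IsFlow K a v) (n : ℤ) :
    Continuous (co v n) :=
  apply_cont n (continuous_S_comp continuous_id h.cont)

theorem IsFlow.cont_nl {K : ℝ} {a : L1} {v : ℝ → L1} (h : IsFlow K a v) (n : ℤ) :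
    Continuous (nl v n) :=
  apply_cont n (continuous_cub.comp (continuous_S_comp continuous_id h.cont))

theorem IsFlow.cont_rt {K : ℝ} {a : L1} {v : ℝ → L1} (h : IsFlow K a v) :
    Continuous (fun t => rt K (v t)) := by
  unfold rt
  have := h.cont
  refine Continuous.div₀ continuous_const (by fun_prop) fun t => ?_
  have := h.pos
  positivity

theorem IsFlow.cont_dco {K : ℝ} {a : L1} {v : ℝ → L1} (h : IsFlow K a v) (n : ℤ) :
    Continuous (dco K v n) := by
  have h1 := h.cont_co n
  have h2 := h.cont_nl n
  have h3 := h.cont_rt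
  unfold dco
  fun_prop

end NLS

namespace NLS

/-! ### Fourier series -/

theorem summable_wt : Summable (fun n : ℤ => (1 : ℝ) / (1 + |(n : ℝ)|) ^ 2) := by
  have h1 : Summable (fun n : ℤ => (1 : ℝ) / (n : ℝ) ^ 2) :=
    Real.summable_one_div_int_pow.mpr (by norm_num)
  refine Summable.of_norm_bounded_eventually h1 ?_
  have : ∀ᶠ n : ℤ in Filter.cofinite, n ≠ 0 := Filter.eventually_cofinite_ne 0
  filter_upwards [this] with n hn
  have hn' : 0 < |(n : ℝ)| := by positivity
  rw [Real.norm_of_nonneg (by positivity), ← sq_abs (n : ℝ)]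
  gcongr
  linarith

theorem Dec.bound {c : ℤ → ℝ → ℂ} (hc : Dec c) (T : ℝ) :
    ∃ b : ℤ → ℝ, Summable b ∧ ∀ n t, |t| ≤ T → ‖c n t‖ ≤ b n := by
  obtain ⟨C, hC⟩ := hc 2 T
  refine ⟨_, summable_wt.mul_left C, fun n t ht => ?_⟩
  have := hC n t ht
  rw [mul_one_div, le_div_iff₀ (by positivity)]
  linarith

theorem Dec.summable {c : ℤ → ℝ → ℂ} (hc : Dec c) (t : ℝ) : Summable (fun n => ‖c n t‖) := by
  obtain ⟨b, hb, h⟩ := hc.bound |t|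
  exact Summable.of_nonneg_of_le (fun n => norm_nonneg _) (fun n => h n t le_rfl) hb

/-- The function with Fourier coefficients `c`. -/
noncomputable def U (c : ℤ → ℝ → ℂ) (x t : ℝ) : ℂ := ∑' n, c n t * e n x

theorem Dec.summable_U {c : ℤ → ℝ → ℂ} (hc : Dec c) (x t : ℝ) :
    Summable (fun n => c n t * e n x) := by
  apply Summable.of_norm
  simp only [norm_mul, norm_e, mul_one]
  exact hc.summable t

theorem e_periodic (n : ℤ) (x : ℝ) : e n (x + 1) = e n x := by
  rw [e, e]
  push_cast
  rw [mul_add, mul_one, Complex.exp_add]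
  have : Complex.exp (2 * π * Complex.I * n) = 1 := by
    rw [mul_comm]
    exact Complex.exp_int_mul_two_pi_mul_I n
  rw [this, mul_one]

theorem U_periodic (c : ℤ → ℝ → ℂ) (x t : ℝ) : U c (x + 1) t = U c x t := by
  simp only [U, e_periodic]

theorem hasDerivAt_e (n : ℤ) (x : ℝ) : HasDerivAt (e n) ((2 * π * Complex.I * n) * e n x) x := by
  have h1 : HasDerivAt (fun x : ℝ => (2 * π * Complex.I * n * x : ℂ)) (2 * π * Complex.I * n) x := by
    simpa using (Complex.ofRealCLM.hasDerivAt (x := x)).const_mul (2 * π * Complex.I * n : ℂ)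
  have := h1.cexp
  rw [mul_comm (2 * π * Complex.I * n : ℂ) (e n x)]
  exact this

theorem continuous_e (n : ℤ) : Continuous (e n) := by
  unfold e
  fun_prop

theorem Dec.hasDerivAt_x {c : ℤ → ℝ → ℂ} (hc : Dec c) (x t : ℝ) :
    HasDerivAt (fun y => U c y t) (U (NLS.Dx c) x t) x := by
  have := hasDerivAt_tsum (u := fun n => ‖NLS.Dx c n t‖) (g := fun n y => c n t * e n y)
    (g' := fun n y => NLS.Dx c n t * e n y) (y₀ := x) (hc.Dx.summable t)
    (fun n y => by
      have := (hasDerivAt_e n y).const_mul (c n t)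
      convert! this using 1
      rw [NLS.Dx]
      ring)
    (fun n y => by rw [norm_mul, norm_e, mul_one]) (hc.summable_U x t) x
  exact this

theorem Dec.hasDerivAt_t {c d : ℤ → ℝ → ℂ} (hc : Dec c) (hd : Dec d)
    (h : ∀ n t, HasDerivAt (c n) (d n t) t) (x t : ℝ) :
    HasDerivAt (fun s => U c x s) (U d x t) t := by
  obtain ⟨b, hb, hbd⟩ := hd.bound (|t| + 1)
  have hm : t ∈ Set.Ioo (-(|t| + 1)) (|t| + 1) := by
    rw [Set.mem_Ioo, ← abs_lt]
    linarith
  exact hasDerivAt_tsum_of_isPreconnected (u := b) (g := fun n s => c n s * e n x)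
    (g' := fun n s => d n s * e n x) (y₀ := t) (t := Set.Ioo (-(|t| + 1)) (|t| + 1)) hb isOpen_Ioo
    (convex_Ioo _ _).isPreconnected (fun n s _ => (h n s).mul_const _)
    (fun n s hs => by
      rw [norm_mul, norm_e, mul_one]
      exact hbd n s (abs_lt.mpr hs).le) hm (hc.summable_U x t) hm

theorem Dec.continuous {c : ℤ → ℝ → ℂ} (hc : Dec c) (h : ∀ n, Continuous (c n)) :
    Continuous (fun p : ℝ × ℝ => U c p.1 p.2) := by
  rw [continuous_iff_continuousAt]
  intro p
  obtain ⟨b, hb, hbd⟩ := hc.bound (|p.2| + 1)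
  have ho : IsOpen {q : ℝ × ℝ | |q.2| < |p.2| + 1} := by
    refine isOpen_lt (by fun_prop) (by fun_prop)
  refine ContinuousOn.continuousAt (s := {q : ℝ × ℝ | |q.2| < |p.2| + 1}) ?_
    (ho.mem_nhds (by simp))
  refine continuousOn_tsum (u := b) (fun n => Continuous.continuousOn ?_) hb fun n q hq => ?_
  · exact ((h n).comp continuous_snd).mul ((continuous_e n).comp continuous_fst)
  · rw [norm_mul, norm_e, mul_one]
    exact hbd n q.2 (le_of_lt hq)

theorem integral_e (n : ℤ) : ∫ x in (0 : ℝ)..1, e n x = if n = 0 then 1 else 0 := by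
  split_ifs with h
  · subst h
    simp [e]
  · have hc : (2 * π * Complex.I * n : ℂ) ≠ 0 := by
      simp [Real.pi_ne_zero, h]
    have := integral_exp_mul_complex (a := 0) (b := 1) hc
    unfold e
    rw [this]
    have h2 : Complex.exp (2 * π * Complex.I * n) = 1 := by
      rw [mul_comm]
      exact Complex.exp_int_mul_two_pi_mul_I n
    simp [h2]

theorem integral_ev (a : L1) : ∫ x in (0 : ℝ)..1, ev x a = a 0 := by
  have h := intervalIntegral.hasSum_intervalIntegral_of_summable_norm (a := 0) (b := 1)
    (f := fun n : ℤ => (⟨fun x => a n * e n x, continuous_const.mul (continuous_e n)⟩ : C(ℝ, ℂ))) (by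
      refine Summable.of_nonneg_of_le (fun n => norm_nonneg _) (fun n => ?_) (summable_norm a)
      rw [ContinuousMap.norm_le _ (norm_nonneg _)]
      intro x
      simp [norm_e])
  simp only [ContinuousMap.coe_mk] at h
  have h2 := h.tsum_eq
  simp only [ev_apply]
  rw [← h2, tsum_eq_single 0]
  · rw [intervalIntegral.integral_const_mul, integral_e]
    simp
  · intro n hn
    rw [intervalIntegral.integral_const_mul, integral_e]
    simp [hn]

theorem integral_ev_mul (a : L1) (n : ℤ) : ∫ x in (0 : ℝ)..1, ev x a * e (-n) x = a n := by
  have := integral_ev (shift (-n) a)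
  simp only [ev_shift, shift_apply] at this
  simp only [mul_comm (ev _ a), this]
  simp

theorem continuous_ev (a : L1) : Continuous (fun x => ev x a) := by
  simp only [ev_apply]
  refine continuous_tsum (u := fun n => ‖a n‖) (fun n => continuous_const.mul (continuous_e n))
    (summable_norm a) fun n x => ?_
  simp [norm_e]

theorem summable_sq (a : L1) : Summable (fun n => ‖a n‖ ^ 2) := by
  refine Summable.of_nonneg_of_le (fun n => by positivity) (fun n => ?_)
    ((summable_norm a).mul_left ‖a‖)
  rw [sq]
  gcongr
  exact apply_le a n

theorem parseval (a : L1) : ∫ x in (0 : ℝ)..1, ‖ev x a‖ ^ 2 = ∑' n, ‖a n‖ ^ 2 := by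
  have := integral_ev (conv a (cj a))
  rw [conv_apply] at this
  simp only [ev_conv, ev_cj, Complex.mul_conj, cj_apply, zero_sub, neg_neg,
    Complex.normSq_eq_norm_sq] at this
  rw [intervalIntegral.integral_ofReal, ← Complex.ofReal_tsum] at this
  exact_mod_cast this

/-- View decaying coefficients at a fixed time as an element of `ℓ¹`. -/
def Dec.at {c : ℤ → ℝ → ℂ} (hc : Dec c) (t : ℝ) : L1 := mk (fun n => c n t) (hc.summable t)

theorem Dec.ev_at {c : ℤ → ℝ → ℂ} (hc : Dec c) (x t : ℝ) : ev x (hc.at t) = U c x t := rfl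

theorem Dec.parseval {c : ℤ → ℝ → ℂ} (hc : Dec c) (t : ℝ) :
    ∫ x in (0 : ℝ)..1, ‖U c x t‖ ^ 2 = ∑' n, ‖c n t‖ ^ 2 := NLS.parseval (hc.at t)

theorem Dec.summable_sq {c : ℤ → ℝ → ℂ} (hc : Dec c) (t : ℝ) :
    Summable (fun n => ‖c n t‖ ^ 2) := NLS.summable_sq (hc.at t)

theorem U_co (v : ℝ → L1) (x t : ℝ) : U (co v) x t = ev x (S t (v t)) := rfl

theorem U_nl (v : ℝ → L1) (x t : ℝ) :
    U (nl v) x t = (‖U (co v) x t‖ : ℂ) ^ 2 * U (co v) x t := ev_cub _ _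

theorem U_add {c d : ℤ → ℝ → ℂ} (hc : Dec c) (hd : Dec d) (x t : ℝ) :
    U (fun n t => c n t + d n t) x t = U c x t + U d x t := by
  unfold U
  rw [← (hc.summable_U x t).tsum_add (hd.summable_U x t)]
  simp only [add_mul]

theorem U_smul (r : ℝ → ℂ) (c : ℤ → ℝ → ℂ) (x t : ℝ) :
    U (fun n t => r t * c n t) x t = r t * U c x t := by
  unfold U
  rw [← tsum_mul_left]
  simp only [mul_assoc]

theorem dco_eq (K : ℝ) (v : ℝ → L1) : dco K v = fun n t =>
    (-Complex.I) * Dx (Dx (co v)) n t + (Complex.I * (rt K (v t) ^ 3 : ℝ)) * nl v n t := by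
  ext n t
  rw [dco, Dx, Dx]
  linear_combination (4 * π ^ 2 * n ^ 2 * co v n t * Complex.I) * Complex.I_sq

theorem Dec.smul {c : ℤ → ℝ → ℂ} (hc : Dec c) (r : ℝ → ℂ) (M : ℝ) (h : ∀ t, ‖r t‖ ≤ M) :
    Dec (fun n t => r t * c n t) := hc.of_le M 0 fun n t => by
  rw [norm_mul, pow_zero, mul_one]
  gcongr
  exact h t

theorem rt_pow_norm {K : ℝ} (hK : 0 < K) (v : L1) : ‖Complex.I * (rt K v ^ 3 : ℝ)‖ ≤ 1 := by
  rw [norm_mul, Complex.norm_I, one_mul, Complex.norm_real,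
    Real.norm_of_nonneg (pow_nonneg (rt_nonneg hK _) _)]
  exact pow_le_one₀ (rt_nonneg hK _) (rt_le_one hK _)

theorem IsFlow.U_dco {K : ℝ} {a : L1} {v : ℝ → L1} (h : IsFlow K a v) (ha : Rapid a) (x t : ℝ) :
    U (dco K v) x t = -Complex.I * U (Dx (Dx (co v))) x t +
      Complex.I * (rt K (v t) ^ 3 : ℝ) * U (nl v) x t := by
  rw [dco_eq, U_add ((h.dec_co ha).Dx.Dx.smul (fun _ => -Complex.I) 1 (by simp))
    ((h.dec_nl ha).smul (fun t => (Complex.I * (rt K (v t) ^ 3 : ℝ))) 1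
      (fun t => rt_pow_norm h.pos _)), U_smul (fun _ => -Complex.I),
      U_smul (fun t => (Complex.I * (rt K (v t) ^ 3 : ℝ)))]

theorem Dx_cont {c : ℤ → ℝ → ℂ} (h : ∀ n, Continuous (c n)) (n : ℤ) : Continuous (Dx c n) :=
  continuous_const.mul (h n)

theorem Dx_der {c d : ℤ → ℝ → ℂ} (h : ∀ n t, HasDerivAt (c n) (d n t) t) (n : ℤ) (t : ℝ) :
    HasDerivAt (Dx c n) (Dx d n t) t := (h n t).const_mul _

end NLS

namespace NLS

/-! ### Energy conservation and removal of the truncation -/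

theorem bootstrap_nonneg {φ : ℝ → ℝ} {K T : ℝ} (hφ : Continuous φ) (h0 : φ 0 ≤ K)
    (h : ∀ t, 0 ≤ t → t ≤ T → (∀ τ, 0 ≤ τ → τ ≤ t → φ τ ≤ K) → φ t < K) (t : ℝ) (ht : 0 ≤ t)
    (htT : t ≤ T) : φ t < K := by
  by_contra! hcon
  have hc : IsCompact (Set.Icc 0 t ∩ {τ | K ≤ φ τ}) :=
    isCompact_Icc.inter_right (isClosed_le continuous_const hφ)
  obtain ⟨m, ⟨⟨hm0, hmt⟩, hmK⟩, hmin⟩ := hc.exists_isLeast ⟨t, ⟨ht, le_rfl⟩, hcon⟩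
  have hmK' : K ≤ φ m := hmK
  have hlt : ∀ τ, 0 ≤ τ → τ < m → φ τ < K := by
    intro τ h1 h2
    by_contra! h3
    have := hmin ⟨⟨h1, by linarith⟩, h3⟩
    linarith
  obtain ⟨τ, ⟨hτ0, hτm⟩, hτ⟩ := intermediate_value_Icc hm0 hφ.continuousOn ⟨h0, hmK'⟩
  have hmτ : m ≤ τ := hmin ⟨⟨hτ0, by linarith⟩, hτ.ge⟩
  have hmeq : φ m = K := by rw [← hτ, le_antisymm hmτ hτm]
  have := h m hm0 (by linarith) fun τ h1 h2 => by
    rcases h2.lt_or_eq with h3 | h3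
    · exact (hlt τ h1 h3).le
    · rw [h3, hmeq]
  linarith

theorem inner_identity (w z q : ℂ) (hq : q = -Complex.I * z + Complex.I * ((‖w‖ : ℂ) ^ 2 * w)) :
    ‖w‖ ^ 2 * inner ℝ w q = inner ℝ z q := by
  rw [Complex.inner, Complex.inner]
  generalize ‖w‖ = r at *
  have h1 : q.re = z.im - r ^ 2 * w.im := by
    rw [hq, ← Complex.ofReal_pow]
    simp [-Complex.ofReal_pow]
    ring
  have h2 : q.im = -z.re + r ^ 2 * w.re := by
    rw [hq, ← Complex.ofReal_pow]
    simp [-Complex.ofReal_pow]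
  simp only [Complex.mul_re, Complex.conj_re, Complex.conj_im, h1, h2]
  ring

/-- Energy density. -/
noncomputable def dens (c : ℤ → ℝ → ℂ) (x t : ℝ) : ℝ :=
  ‖U (Dx c) x t‖ ^ 2 + 1 / 2 * (‖U c x t‖ ^ 2) ^ 2

/-- Energy. -/
noncomputable def En (c : ℤ → ℝ → ℂ) (t : ℝ) : ℝ := ∫ x in (0 : ℝ)..1, dens c x t

/-- Time derivative of the energy density. -/
noncomputable def ddens (c d : ℤ → ℝ → ℂ) (x t : ℝ) : ℝ :=
  2 * inner ℝ (U (Dx c) x t) (U (Dx d) x t) + 2 * (‖U c x t‖ ^ 2 * inner ℝ (U c x t) (U d x t))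

theorem hasDerivAt_dens {c d : ℤ → ℝ → ℂ} (hc : Dec c) (hd : Dec d)
    (h : ∀ n t, HasDerivAt (c n) (d n t) t) (x t : ℝ) :
    HasDerivAt (fun s => dens c x s) (ddens c d x t) t := by
  have h0 := (hc.hasDerivAt_t hd h x t).norm_sq
  have h1 := (hc.Dx.hasDerivAt_t hd.Dx (Dx_der h) x t).norm_sq
  have := h1.add ((h0.pow 2).const_mul (1 / 2))
  convert! this using 1
  rw [ddens]
  simp
  ring

theorem cont_fst {f : ℝ × ℝ → ℝ} (hf : Continuous f) (t : ℝ) : Continuous (fun x => f (x, t)) := by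
  fun_prop

theorem hasDerivAt_En {c d : ℤ → ℝ → ℂ} (hc : Dec c) (hd : Dec d)
    (hcc : ∀ n, Continuous (c n)) (hdc : ∀ n, Continuous (d n))
    (h : ∀ n t, HasDerivAt (c n) (d n t) t) (t : ℝ) :
    HasDerivAt (En c) (∫ x in (0 : ℝ)..1, ddens c d x t) t := by
  have c0 := hc.continuous hcc
  have c1 := hc.Dx.continuous (Dx_cont hcc)
  have d0 := hd.continuous hdc
  have d1 := hd.Dx.continuous (Dx_cont hdc)
  have hC : Continuous (fun p : ℝ × ℝ => dens c p.1 p.2) := by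
    unfold dens
    fun_prop
  have hD : Continuous (fun p : ℝ × ℝ => ddens c d p.1 p.2) := by
    unfold ddens
    fun_prop
  obtain ⟨B, hB⟩ := ((isCompact_Icc (a := (0 : ℝ)) (b := 1)).prod
    (isCompact_Icc (a := t - 1) (b := t + 1))).exists_bound_of_continuousOn hD.continuousOn
  have := intervalIntegral.hasDerivAt_integral_of_dominated_loc_of_deriv_le
    (F := fun s x => dens c x s) (F' := fun s x => ddens c d x s) (x₀ := t) (a := 0) (b := 1)
    (s := Set.Icc (t - 1) (t + 1)) (bound := fun _ => B) (μ := MeasureTheory.volume)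
    (Icc_mem_nhds (by linarith) (by linarith))
    (Filter.Eventually.of_forall fun s => (cont_fst hC s).aestronglyMeasurable)
    ((cont_fst hC t).intervalIntegrable 0 1) (cont_fst hD t).aestronglyMeasurable
    (Filter.Eventually.of_forall fun x hx s hs => by
      rw [Set.uIoc_of_le zero_le_one] at hx
      exact hB (x, s) ⟨⟨hx.1.le, hx.2⟩, hs⟩)
    (by simp)
    (Filter.Eventually.of_forall fun x hx s hs => hasDerivAt_dens hc hd h x s)
  exact this.2

theorem integral_ddens {c d : ℤ → ℝ → ℂ} (hc : Dec c) (hd : Dec d)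
    (hcc : ∀ n, Continuous (c n)) (hdc : ∀ n, Continuous (d n)) (t : ℝ)
    (hq : ∀ x, U d x t = -Complex.I * U (Dx (Dx c)) x t +
      Complex.I * ((‖U c x t‖ : ℂ) ^ 2 * U c x t)) :
    ∫ x in (0 : ℝ)..1, ddens c d x t = 0 := by
  have c0 := hc.continuous hcc
  have c1 := hc.Dx.continuous (Dx_cont hcc)
  have d0 := hd.continuous hdc
  have d1 := hd.Dx.continuous (Dx_cont hdc)
  have hD : Continuous (fun p : ℝ × ℝ => ddens c d p.1 p.2) := by
    unfold ddens
    fun_prop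
  have key : ∀ x, HasDerivAt (fun y => 2 * (inner ℝ (U (Dx c) y t) (U d y t) : ℝ))
      (ddens c d x t) x := by
    intro x
    have := ((hc.Dx.hasDerivAt_x x t).inner ℝ (hd.hasDerivAt_x x t)).const_mul 2
    convert! this using 1
    rw [ddens, inner_identity _ _ _ (hq x)]
    ring
  rw [intervalIntegral.integral_eq_sub_of_hasDerivAt (fun x _ => key x)
    ((cont_fst hD t).intervalIntegrable 0 1)]
  have p1 := U_periodic (Dx c) 0 t
  have p2 := U_periodic d 0 t
  rw [zero_add] at p1 p2
  rw [p1, p2, sub_self]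

theorem IsFlow.energy {K : ℝ} {a : L1} {v : ℝ → L1} (h : IsFlow K a v) (ha : Rapid a) (t : ℝ)
    (ht : ∀ τ ∈ Set.uIcc 0 t, ‖v τ‖ ≤ K) : En (co v) t = En (co v) 0 := by
  have hder := hasDerivAt_En (h.dec_co ha) (h.dec_dco ha) h.cont_co h.cont_dco h.der_co
  have hz : ∀ τ ∈ Set.uIcc 0 t, HasDerivWithinAt (En (co v)) 0 (Set.uIcc 0 t) τ := by
    intro τ hτ
    have h1 := hder τ
    rw [integral_ddens (h.dec_co ha) (h.dec_dco ha) h.cont_co h.cont_dco τ] at h1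
    · exact h1.hasDerivWithinAt
    · intro x
      rw [h.U_dco ha, rt_eq_one h.pos (ht τ hτ), U_nl]
      simp
  have := Convex.norm_image_sub_le_of_norm_hasDerivWithin_le (C := 0) hz (by simp)
    (convex_uIcc 0 t) Set.left_mem_uIcc Set.right_mem_uIcc
  rw [zero_mul, norm_le_zero_iff, sub_eq_zero] at this
  exact this

/-- A constant. -/
noncomputable def S0 : ℝ := ∑' n : ℤ, (1 : ℝ) / (1 + |(n : ℝ)|) ^ 2

theorem IsFlow.norm_le_En {K : ℝ} {a : L1} {v : ℝ → L1} (h : IsFlow K a v) (ha : Rapid a) (t : ℝ) :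
    ‖v t‖ ≤ 1 / 2 * S0 + 1 / 2 + En (co v) t := by
  have hc := h.dec_co ha
  have hcc := h.cont_co
  have c0 := hc.continuous hcc
  have c1 := hc.Dx.continuous (Dx_cont hcc)
  have hC : Continuous (fun p : ℝ × ℝ => dens (co v) p.1 p.2) := by
    unfold dens
    fun_prop
  have i0 : ∫ x in (0 : ℝ)..1, (‖U (co v) x t‖ ^ 2 + ‖U (Dx (co v)) x t‖ ^ 2) ≤
      ∫ x in (0 : ℝ)..1, (1 / 2 + dens (co v) x t) := by
    refine intervalIntegral.integral_mono_on zero_le_one ?_ ?_ fun x _ => ?_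
    · refine (Continuous.intervalIntegrable ?_ 0 1)
      exact cont_fst (f := fun p : ℝ × ℝ => ‖U (co v) p.1 p.2‖ ^ 2 + ‖U (Dx (co v)) p.1 p.2‖ ^ 2)
        (by fun_prop) t
    · exact Continuous.intervalIntegrable (continuous_const.add (cont_fst hC t)) 0 1
    · rw [dens]
      nlinarith [sq_nonneg (‖U (co v) x t‖ ^ 2 - 1)]
  rw [intervalIntegral.integral_add, intervalIntegral.integral_add, hc.parseval, hc.Dx.parseval]
    at i0
  rotate_left
  · simp
  · exact (cont_fst hC t).intervalIntegrable 0 1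
  · exact (cont_fst (f := fun p : ℝ × ℝ => ‖U (co v) p.1 p.2‖ ^ 2)
        (by fun_prop) t).intervalIntegrable 0 1
  · exact (cont_fst (f := fun p : ℝ × ℝ => ‖U (Dx (co v)) p.1 p.2‖ ^ 2)
        (by fun_prop) t).intervalIntegrable 0 1
  rw [intervalIntegral.integral_const, sub_zero, one_smul] at i0
  have s0 := hc.summable_sq t
  have s1 := hc.Dx.summable_sq t
  have h2 : ‖v t‖ ≤ 1 / 2 * S0 + (∑' n, ‖co v n t‖ ^ 2 + ∑' n, ‖Dx (co v) n t‖ ^ 2) := by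
    rw [norm_eq, S0, ← tsum_mul_left, ← s0.tsum_add s1,
      ← (summable_wt.mul_left _).tsum_add (s0.add s1)]
    refine (summable_norm _).tsum_le_tsum (fun n => ?_)
      ((summable_wt.mul_left _).add (s0.add s1))
    have e1 : ‖v t n‖ = ‖co v n t‖ := by simp [co, norm_ph]
    have e2 : ‖Dx (co v) n t‖ = 2 * π * |(n : ℝ)| * ‖co v n t‖ := by
      simp [Dx, abs_of_pos Real.pi_pos]
    rw [e1, e2]
    set y := ‖co v n t‖
    set m := |(n : ℝ)|
    have hm : 0 ≤ m := abs_nonneg _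
    have hpi : 1 ≤ 2 * π := by linarith [Real.pi_gt_three]
    have hw : 1 / (1 + m) ^ 2 * (1 + m) ^ 2 = 1 := by
      field_simp
    have q1 : y ≤ 1 / 2 * (1 / (1 + m) ^ 2) + 1 / 2 * ((1 + m) * y) ^ 2 := by
      have : 1 / (1 + m) ^ 2 = (1 / (1 + m)) ^ 2 := by field_simp
      rw [this]
      have h3 : 1 / (1 + m) * ((1 + m) * y) = y := by field_simp
      nlinarith [sq_nonneg (1 / (1 + m) - (1 + m) * y)]
    have q2 : (m * y) ^ 2 ≤ (2 * π * m * y) ^ 2 := by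
      have : 0 ≤ y := norm_nonneg _
      gcongr
      nlinarith
    nlinarith [sq_nonneg (y - m * y)]
  have : En (co v) t = ∫ x in (0 : ℝ)..1, dens (co v) x t := rfl
  linarith

theorem En_init {K : ℝ} {a : L1} {v : ℝ → L1} (h : IsFlow K a v) :
    En (co v) 0 = En (fun n _ => a n) 0 := by
  unfold En dens U Dx
  simp [co, h.start, ph_zero]

theorem En_nonneg (c : ℤ → ℝ → ℂ) (t : ℝ) : 0 ≤ En c t := by
  refine intervalIntegral.integral_nonneg zero_le_one fun x _ => ?_
  unfold dens
  positivity

/-- Global existence without truncation. -/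
theorem exists_solution (a : L1) (ha : Rapid a) :
    ∃ (K : ℝ) (v : ℝ → L1), IsFlow K a v ∧ ∀ t, ‖v t‖ ≤ K := by
  have hS : 0 ≤ S0 := tsum_nonneg fun n => by positivity
  have hE := En_nonneg (fun n _ => a n) 0
  set K : ℝ := 1 / 2 * S0 + 1 / 2 + En (fun n _ => a n) 0 + 1 with hKdef
  have hK : 0 < K := by linarith
  obtain ⟨v, h0, hd⟩ := exists_flow hK a
  have h : IsFlow K a v := ⟨hK, h0, hd⟩
  have h00 : ‖v 0‖ ≤ K := by
    have := h.norm_le_En ha 0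
    rw [En_init h] at this
    linarith
  have main : ∀ t, (∀ τ ∈ Set.uIcc 0 t, ‖v τ‖ ≤ K) → ‖v t‖ < K := by
    intro t ht
    have := h.norm_le_En ha t
    rw [h.energy ha t ht, En_init h] at this
    linarith
  refine ⟨K, v, h, fun t => ?_⟩
  rcases le_total 0 t with ht | ht
  · refine (bootstrap_nonneg (φ := fun t => ‖v t‖) (T := t) h.cont.norm h00 ?_ t ht le_rfl).le
    intro s hs _ hh
    refine main s fun τ hτ => ?_
    rw [Set.uIcc_of_le hs] at hτ
    exact hh τ hτ.1 hτ.2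
  · have := (bootstrap_nonneg (φ := fun t => ‖v (-t)‖) (K := K) (T := -t)
      (h.cont.comp continuous_neg).norm (by simpa using h00) ?_ (-t) (by linarith) le_rfl).le
    · simpa using this
    intro s hs _ hh
    refine main (-s) fun τ hτ => ?_
    rw [Set.uIcc_of_ge (by linarith)] at hτ
    have := hh (-τ) (by linarith [hτ.2]) (by linarith [hτ.1])
    simpa using this

end NLS

namespace NLS

/-! ### Smoothness -/

/-- Iterated `x`-derivative on the Fourier side. -/
noncomputable def Dk : ℕ → (ℤ → ℝ → ℂ) → ℤ → ℝ → ℂ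
  | 0, c => c
  | k + 1, c => Dx (Dk k c)

theorem Dk_apply (k : ℕ) (c : ℤ → ℝ → ℂ) (n : ℤ) (t : ℝ) :
    Dk k c n t = (2 * π * Complex.I * n) ^ k * c n t := by
  induction k with
  | zero => simp [Dk]
  | succ k ih =>
    rw [Dk, Dx, ih]
    ring

theorem Dec.Dk {c : ℤ → ℝ → ℂ} (hc : Dec c) (k : ℕ) : Dec (Dk k c) := by
  induction k with
  | zero => exact hc
  | succ k ih => exact ih.Dx

theorem Dk_cont {c : ℤ → ℝ → ℂ} (h : ∀ n, Continuous (c n)) (k : ℕ) : ∀ n, Continuous (Dk k c n) := by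
  induction k with
  | zero => exact h
  | succ k ih => exact Dx_cont ih

theorem Dk_der {c d : ℤ → ℝ → ℂ} (h : ∀ n t, HasDerivAt (c n) (d n t) t) (k : ℕ) :
    ∀ n t, HasDerivAt (Dk k c n) (Dk k d n t) t := by
  induction k with
  | zero => exact h
  | succ k ih => exact Dx_der ih

theorem hasFDerivAt_of_partial {f fx ft : ℝ → ℝ → ℂ}
    (hx : ∀ x t, HasDerivAt (fun y => f y t) (fx x t) x)
    (ht : ∀ x t, HasDerivAt (fun s => f x s) (ft x t) t)
    (cx : Continuous (fun p : ℝ × ℝ => fx p.1 p.2)) (ct : Continuous (fun p : ℝ × ℝ => ft p.1 p.2))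
    (p : ℝ × ℝ) : HasFDerivAt (fun p : ℝ × ℝ => f p.1 p.2)
      ((ContinuousLinearMap.toSpanSingleton ℝ (fx p.1 p.2)).coprod
        (ContinuousLinearMap.toSpanSingleton ℝ (ft p.1 p.2))) p := by
  have := hasStrictFDerivAt_uncurry_coprod (𝕜 := ℝ) (u := p) (f := f)
    (f₁ := fun x t => ContinuousLinearMap.toSpanSingleton ℝ (fx x t))
    (f₂ := fun x t => ContinuousLinearMap.toSpanSingleton ℝ (ft x t))
    (Filter.Eventually.of_forall fun q => (hx q.1 q.2).hasFDerivAt)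
    (Filter.Eventually.of_forall fun q => (ht q.1 q.2).hasFDerivAt)
    (((ContinuousLinearMap.toSpanSingletonCLE (𝕜 := ℝ) (E := ℂ)).continuous.comp cx).continuousAt)
    (((ContinuousLinearMap.toSpanSingletonCLE (𝕜 := ℝ) (E := ℂ)).continuous.comp ct).continuousAt)
  exact this.hasFDerivAt

theorem contDiff_succ_of_partial {f fx ft : ℝ → ℝ → ℂ} {m : ℕ}
    (hx : ∀ x t, HasDerivAt (fun y => f y t) (fx x t) x)
    (ht : ∀ x t, HasDerivAt (fun s => f x s) (ft x t) t)
    (cx : ContDiff ℝ m (fun p : ℝ × ℝ => fx p.1 p.2))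
    (ct : ContDiff ℝ m (fun p : ℝ × ℝ => ft p.1 p.2)) :
    ContDiff ℝ (m + 1) (fun p : ℝ × ℝ => f p.1 p.2) := by
  rw [contDiff_succ_iff_hasFDerivAt]
  refine ⟨fun p => (ContinuousLinearMap.fst ℝ ℝ ℝ).smulRight (fx p.1 p.2) +
    (ContinuousLinearMap.snd ℝ ℝ ℝ).smulRight (ft p.1 p.2), ?_, fun p => ?_⟩
  · exact (contDiff_const.smulRight cx).add (contDiff_const.smulRight ct)
  · convert! hasFDerivAt_of_partial hx ht cx.continuous ct.continuous p using 1

/-- Polynomial expressions in a family of functions and their conjugates. -/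
inductive Pol (f : ℕ → ℝ → ℝ → ℂ) : (ℝ → ℝ → ℂ) → Prop
  | base (k : ℕ) : Pol f (f k)
  | conj {g : ℝ → ℝ → ℂ} : Pol f g → Pol f (fun x t => starRingEnd ℂ (g x t))
  | add {g h : ℝ → ℝ → ℂ} : Pol f g → Pol f h → Pol f (fun x t => g x t + h x t)
  | mul {g h : ℝ → ℝ → ℂ} : Pol f g → Pol f h → Pol f (fun x t => g x t * h x t)

theorem Pol.der {f : ℕ → ℝ → ℝ → ℂ}
    (hf : ∀ k x t, HasDerivAt (fun y => f k y t) (f (k + 1) x t) x)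
    {g : ℝ → ℝ → ℂ} (hg : Pol f g) :
    ∃ g', Pol f g' ∧ ∀ x t, HasDerivAt (fun y => g y t) (g' x t) x := by
  induction hg with
  | base k => exact ⟨_, Pol.base (k + 1), hf k⟩
  | conj _ ih =>
    obtain ⟨g', h1, h2⟩ := ih
    exact ⟨_, h1.conj, fun x t => Complex.conjCLE.hasFDerivAt.comp_hasDerivAt x (h2 x t)⟩
  | add _ _ ih1 ih2 =>
    obtain ⟨g', h1, h2⟩ := ih1
    obtain ⟨k', h3, h4⟩ := ih2
    exact ⟨_, h1.add h3, fun x t => (h2 x t).add (h4 x t)⟩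
  | mul hg hk ih1 ih2 =>
    obtain ⟨g', h1, h2⟩ := ih1
    obtain ⟨k', h3, h4⟩ := ih2
    exact ⟨_, (h1.mul hk).add (hg.mul h3), fun x t => (h2 x t).mul (h4 x t)⟩

theorem Pol.contDiff {f : ℕ → ℝ → ℝ → ℂ} {m : ℕ}
    (hf : ∀ k, ContDiff ℝ m (fun p : ℝ × ℝ => f k p.1 p.2))
    {g : ℝ → ℝ → ℂ} (hg : Pol f g) : ContDiff ℝ m (fun p : ℝ × ℝ => g p.1 p.2) := by
  induction hg with
  | base k => exact hf k
  | conj _ ih => exact Complex.conjCLE.contDiff.comp ih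
  | add _ _ ih1 ih2 => exact ih1.add ih2
  | mul hg hk ih1 ih2 => exact ih1.mul ih2

section

variable {K : ℝ} {a : L1} {v : ℝ → L1}

theorem IsFlow.pol_nl (h : IsFlow K a v) (ha : Rapid a) (k : ℕ) :
    Pol (fun k => U (Dk k (co v))) (U (Dk k (nl v))) := by
  have hf : ∀ k x t, HasDerivAt (fun y => U (Dk k (co v)) y t) (U (Dk (k + 1) (co v)) x t) x :=
    fun k x t => ((h.dec_co ha).Dk k).hasDerivAt_x x t
  induction k with
  | zero =>
    have b := Pol.base (f := fun k => U (Dk k (co v))) 0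
    have := (b.mul b.conj).mul b
    convert! this using 1
    funext x t
    rw [Dk, Dk, U_nl, Complex.mul_conj, Complex.normSq_eq_norm_sq]
    push_cast
    rfl
  | succ k ih =>
    obtain ⟨g', h1, h2⟩ := ih.der hf
    convert! h1 using 1
    funext x t
    exact (((h.dec_nl ha).Dk k).hasDerivAt_x x t).unique (h2 x t)

theorem IsFlow.U_dco_k (h : IsFlow K a v) (ha : Rapid a) (hK : ∀ t, ‖v t‖ ≤ K) (k : ℕ) (x t : ℝ) :
    U (Dk k (dco K v)) x t = -Complex.I * U (Dk (k + 2) (co v)) x t +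
      Complex.I * U (Dk k (nl v)) x t := by
  have : Dk k (dco K v) = fun n t => (-Complex.I) * Dk (k + 2) (co v) n t +
      Complex.I * Dk k (nl v) n t := by
    ext n t
    rw [Dk_apply, Dk_apply, Dk_apply, dco_eq]
    simp only [Dx]
    rw [rt_eq_one h.pos (hK t)]
    push_cast
    ring
  rw [this, U_add (((h.dec_co ha).Dk (k + 2)).smul (fun _ => -Complex.I) 1 (by simp))
    (((h.dec_nl ha).Dk k).smul (fun t => Complex.I) 1 (by simp)), U_smul (fun _ => -Complex.I),
      U_smul (fun t => Complex.I)]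

theorem IsFlow.contDiff_nat (h : IsFlow K a v) (ha : Rapid a) (hK : ∀ t, ‖v t‖ ≤ K) (m : ℕ) :
    ∀ k, ContDiff ℝ m (fun p : ℝ × ℝ => U (Dk k (co v)) p.1 p.2) := by
  induction m with
  | zero =>
    intro k
    exact contDiff_zero.mpr (((h.dec_co ha).Dk k).continuous (Dk_cont h.cont_co k))
  | succ m ih =>
    intro k
    refine contDiff_succ_of_partial (fun x t => ((h.dec_co ha).Dk k).hasDerivAt_x x t)
      (fun x t => ((h.dec_co ha).Dk k).hasDerivAt_t ((h.dec_dco ha).Dk k) (Dk_der h.der_co k) x t)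
      (ih (k + 1)) ?_
    simp only [h.U_dco_k ha hK]
    exact (contDiff_const.mul (ih (k + 2))).add
      (contDiff_const.mul (Pol.contDiff ih (h.pol_nl ha k)))

theorem IsFlow.contDiff (h : IsFlow K a v) (ha : Rapid a) (hK : ∀ t, ‖v t‖ ≤ K) :
    ContDiff ℝ (⊤ : ℕ∞) (fun p : ℝ × ℝ => U (co v) p.1 p.2) :=
  contDiff_infty.mpr fun m => h.contDiff_nat ha hK m 0

theorem IsFlow.pde (h : IsFlow K a v) (ha : Rapid a) (hK : ∀ t, ‖v t‖ ≤ K) (x t : ℝ) :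
    Complex.I * deriv (fun τ => U (co v) x τ) t
      - deriv (deriv fun y => U (co v) y t) x
      + (‖U (co v) x t‖ : ℂ)^2 * U (co v) x t = 0 := by
  have hc := h.dec_co ha
  rw [(hc.hasDerivAt_t (h.dec_dco ha) h.der_co x t).deriv]
  have h1 : (deriv fun y => U (co v) y t) = fun y => U (Dx (co v)) y t := by
    funext y
    exact (hc.hasDerivAt_x y t).deriv
  rw [h1, (hc.Dx.hasDerivAt_x x t).deriv]
  have h2 := h.U_dco_k ha hK 0 x t
  simp only [Dk] at h2
  rw [h2, ← U_nl]
  linear_combination (U (nl v) x t - U (Dx (Dx (co v))) x t) * Complex.I_sq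

end

end NLS

namespace NLS

/-! ### The initial data -/

/-- The real coefficients of the data. -/
noncomputable def al (N : ℕ) (R : ℝ) (n : ℤ) : ℝ := if n ∈ Finset.Icc (N : ℤ) (5 * N) then R else 0

theorem al_nonneg {N : ℕ} {R : ℝ} (hR : 0 ≤ R) (n : ℤ) : 0 ≤ al N R n := by
  unfold al
  split_ifs <;> simp [hR]

theorem al_le {N : ℕ} {R : ℝ} (hR : 0 ≤ R) (n : ℤ) : al N R n ≤ R := by
  unfold al
  split_ifs <;> simp [hR]

theorem al_of_mem {N : ℕ} (R : ℝ) {n : ℤ} (h1 : (N : ℤ) ≤ n) (h2 : n ≤ 5 * N) : al N R n = R := by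
  unfold al
  rw [if_pos (Finset.mem_Icc.mpr ⟨h1, h2⟩)]

theorem al_of_not_mem {N : ℕ} (R : ℝ) {n : ℤ} (h : n ∉ Finset.Icc (N : ℤ) (5 * N)) :
    al N R n = 0 := by
  unfold al
  rw [if_neg h]

/-- The data. -/
noncomputable def dat (N : ℕ) (R : ℝ) : L1 := mk (fun n => (al N R n : ℂ)) (by
  refine summable_of_ne_finset_zero (s := Finset.Icc (N : ℤ) (5 * N)) fun n hn => ?_
  rw [al_of_not_mem R hn]
  simp)

theorem dat_apply (N : ℕ) (R : ℝ) (n : ℤ) : dat N R n = (al N R n : ℂ) := rfl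

theorem norm_dat_apply {N : ℕ} {R : ℝ} (hR : 0 ≤ R) (n : ℤ) : ‖dat N R n‖ = al N R n := by
  rw [dat_apply, Complex.norm_real, Real.norm_of_nonneg (al_nonneg hR n)]

theorem norm_dat {N : ℕ} {R : ℝ} (hR : 0 ≤ R) : ‖dat N R‖ = (4 * N + 1) * R := by
  rw [norm_eq]
  simp only [norm_dat_apply hR]
  rw [tsum_eq_sum (s := Finset.Icc (N : ℤ) (5 * N)) fun n hn => al_of_not_mem R hn]
  rw [Finset.sum_congr rfl (g := fun _ => R) fun n hn => by unfold al; rw [if_pos hn]]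
  rw [Finset.sum_const, Int.card_Icc, nsmul_eq_mul]
  congr 1
  rw [show (5 * (N : ℤ) + 1 - N).toNat = 4 * N + 1 by omega]
  push_cast
  ring

theorem rapid_dat (N : ℕ) (R : ℝ) : Rapid (dat N R) := by
  intro k
  refine ⟨∑ n ∈ Finset.Icc (N : ℤ) (5 * N), (1 + |(n : ℝ)|) ^ k * ‖dat N R n‖, fun M => ?_⟩
  rw [norm_eq, tsum_eq_sum (s := Finset.Icc (N : ℤ) (5 * N))]
  · refine Finset.sum_le_sum fun n _ => ?_
    rw [W_apply, norm_mul, norm_wt]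
    gcongr
    exact min_le_left _ _
  · intro n hn
    rw [W_apply, dat_apply, al_of_not_mem R hn]
    simp

theorem cub_dat {N : ℕ} {R : ℝ} (hR : 0 ≤ R) {n : ℤ} (h0 : 0 ≤ n) (hn : n < N) :
    R ^ 3 * N ^ 2 ≤ ‖cub (dat N R) n‖ := by
  have h1 : ∀ p, conv (dat N R) (dat N R) p = ((∑' q, al N R q * al N R (p - q) : ℝ) : ℂ) := by
    intro p
    rw [conv_apply, Complex.ofReal_tsum]
    simp [dat_apply]
  have hb : ∀ p, 0 ≤ ∑' q, al N R q * al N R (p - q) := fun p =>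
    tsum_nonneg fun q => mul_nonneg (al_nonneg hR _) (al_nonneg hR _)
  have hb2 : ∀ p : ℤ, 3 * N ≤ p → p < 4 * N → R ^ 2 * N ≤ ∑' q, al N R q * al N R (p - q) := by
    intro p hp1 hp2
    rw [tsum_eq_sum (s := Finset.Icc (N : ℤ) (5 * N)) fun q hq => by
      rw [al_of_not_mem R hq, zero_mul]]
    calc R ^ 2 * N = ∑ q ∈ Finset.Ico (N : ℤ) (2 * N), R * R := by
          rw [Finset.sum_const, Int.card_Ico, nsmul_eq_mul,
            show (2 * (N : ℤ) - N).toNat = N by omega]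
          ring
      _ = ∑ q ∈ Finset.Ico (N : ℤ) (2 * N), al N R q * al N R (p - q) := by
          refine Finset.sum_congr rfl fun q hq => ?_
          rw [Finset.mem_Ico] at hq
          rw [al_of_mem R (by omega) (by omega), al_of_mem R (by omega) (by omega)]
      _ ≤ _ := by
          refine Finset.sum_le_sum_of_subset_of_nonneg (fun q hq => ?_)
            fun q _ _ => mul_nonneg (al_nonneg hR _) (al_nonneg hR _)
          rw [Finset.mem_Ico] at hq
          rw [Finset.mem_Icc]
          omega
  have h2 : cub (dat N R) n =
      ((∑' p, (∑' q, al N R q * al N R (p - q)) * al N R (p - n) : ℝ) : ℂ) := by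
    rw [cub, conv_apply, Complex.ofReal_tsum]
    congr 1
    funext p
    rw [h1, cj_apply, dat_apply, Complex.conj_ofReal, neg_sub, Complex.ofReal_mul]
  rw [h2, Complex.norm_real]
  refine le_trans ?_ (Real.le_norm_self _)
  rw [tsum_eq_sum (s := Finset.Icc ((N : ℤ) + n) (5 * N + n)) fun p hp => by
      rw [al_of_not_mem R (n := p - n) fun hp2 => hp (by rw [Finset.mem_Icc] at *; omega), mul_zero]]
  calc R ^ 3 * N ^ 2 = ∑ q ∈ Finset.Ico (3 * N : ℤ) (4 * N), (R ^ 2 * N) * R := by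
          rw [Finset.sum_const, Int.card_Ico, nsmul_eq_mul,
            show (4 * (N : ℤ) - 3 * N).toNat = N by omega]
          ring
    _ ≤ ∑ p ∈ Finset.Ico (3 * N : ℤ) (4 * N),
          (∑' q, al N R q * al N R (p - q)) * al N R (p - n) := by
          refine Finset.sum_le_sum fun q hq => ?_
          rw [Finset.mem_Ico] at hq
          rw [al_of_mem R (n := q - n) (by omega) (by omega)]
          exact mul_le_mul_of_nonneg_right (hb2 q hq.1 hq.2) hR
    _ ≤ _ := by
          refine Finset.sum_le_sum_of_subset_of_nonneg (fun q hq => ?_)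
            fun q _ _ => mul_nonneg (hb _) (al_nonneg hR _)
          rw [Finset.mem_Ico] at hq
          rw [Finset.mem_Icc]
          omega

/-! ### The inflation mechanism -/

theorem seg {E : Type*} [NormedAddCommGroup E] [NormedSpace ℝ E] {f f' : ℝ → E} {C t : ℝ}
    (hf : ∀ t, HasDerivAt f (f' t) t) (hC : ∀ τ, 0 ≤ τ → τ ≤ t → ‖f' τ‖ ≤ C) (ht : 0 ≤ t) :
    ‖f t - f 0‖ ≤ C * t := by
  have := norm_image_sub_le_of_norm_deriv_le_segment' (f := f) (f' := f') (a := 0) (b := t) (C := C)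
    (fun x _ => (hf x).hasDerivWithinAt) (fun x hx => hC x hx.1 hx.2.le) t ⟨ht, le_rfl⟩
  rwa [sub_zero] at this

theorem ph_sub_one (n : ℤ) (t : ℝ) : ‖ph n t - 1‖ ≤ 40 * (n : ℝ) ^ 2 * |t| := by
  have h1 : ‖ph n t - 1‖ ≤ ‖(4 * π ^ 2 * n ^ 2 * t : ℝ)‖ := by
    rw [ph, mul_comm]
    exact Real.norm_exp_I_mul_ofReal_sub_one_le
  refine h1.trans ?_
  rw [norm_mul, Real.norm_of_nonneg (by positivity), Real.norm_eq_abs]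
  have : π ^ 2 ≤ 10 := by nlinarith [Real.pi_lt_d2, Real.pi_pos]
  gcongr
  linarith

section

variable {K : ℝ} {a : L1} {v : ℝ → L1}

theorem F_apply_one (hKpos : 0 < K) {w : L1} (hK : ‖w‖ ≤ K) (t : ℝ) (n : ℤ) :
    F K t w n = Complex.I * (ph n (-t) * cub (S t w) n) := by
  rw [F_apply, rt_eq_one hKpos hK]
  simp

theorem norm_F_one (hKpos : 0 < K) {w : L1} (hK : ‖w‖ ≤ K) (t : ℝ) :
    ‖F K t w‖ ≤ ‖w‖ ^ 3 := by
  rw [F, rt_eq_one hKpos hK, one_smul, norm_smul, Complex.norm_I, one_mul, norm_S]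
  refine (norm_cub_le _).trans ?_
  rw [norm_S]

theorem IsFlow.norm_two (h : IsFlow K a v) (hK : ∀ t, ‖v t‖ ≤ K) {T : ℝ} (hA : 0 < ‖a‖)
    (hT : T * ‖a‖ ^ 2 ≤ 1 / 16) (t : ℝ) (ht : 0 ≤ t) (htT : t ≤ T) : ‖v t‖ ≤ 2 * ‖a‖ := by
  refine (bootstrap_nonneg (φ := fun t => ‖v t‖) h.cont.norm (by rw [h.start]; linarith) ?_
    t ht htT).le
  intro t ht htT hh
  have h1 := seg (C := 8 * ‖a‖ ^ 3) h.der (fun τ h1 h2 => by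
    refine (norm_F_one h.pos (hK τ) τ).trans ?_
    have := hh τ h1 h2
    calc ‖v τ‖ ^ 3 ≤ (2 * ‖a‖) ^ 3 := by gcongr
      _ = _ := by ring) ht
  rw [h.start] at h1
  have h2 : ‖v t‖ ≤ ‖a‖ + ‖v t - a‖ := by
    have := norm_add_le a (v t - a)
    rwa [add_sub_cancel] at this
  have h3 : t * ‖a‖ ^ 2 ≤ 1 / 16 := le_trans (by gcongr) hT
  have h4 : 8 * ‖a‖ ^ 3 * t = 8 * ‖a‖ * (t * ‖a‖ ^ 2) := by ring
  have h5 : ‖a‖ * (t * ‖a‖ ^ 2) ≤ ‖a‖ * (1 / 16) := by gcongr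
  show ‖v t‖ < 2 * ‖a‖
  nlinarith

theorem IsFlow.sup_step (h : IsFlow K a v) (hK : ∀ t, ‖v t‖ ≤ K) {T m : ℝ} (hA : 0 < ‖a‖)
    (hT : T * ‖a‖ ^ 2 ≤ 1 / 16) (hm : ∀ t, 0 ≤ t → t ≤ T → ∀ n, ‖v t n‖ ≤ m)
    (t : ℝ) (ht : 0 ≤ t) (htT : t ≤ T) (n : ℤ) : ‖v t n - a n‖ ≤ 4 * ‖a‖ ^ 2 * m * t := by
  have := seg (f := fun t => v t n) (C := 4 * ‖a‖ ^ 2 * m) (fun t => apply_der n (h.der t))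
    (fun τ h1 h2 => by
      rw [F_apply_one h.pos (hK τ), norm_mul, norm_mul, Complex.norm_I, norm_ph, one_mul, one_mul]
      have hm0 : 0 ≤ m := (norm_nonneg _).trans (hm τ h1 (h2.trans htT) 0)
      refine (cub_sup _ m (fun k => ?_) n).trans ?_
      · rw [S_apply, norm_mul, norm_ph, one_mul]
        exact hm τ h1 (h2.trans htT) k
      · rw [norm_S]
        have := h.norm_two hK hA hT τ h1 (h2.trans htT)
        calc ‖v τ‖ ^ 2 * m ≤ (2 * ‖a‖) ^ 2 * m := by gcongr
          _ = _ := by ring) ht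
  rwa [h.start] at this

theorem IsFlow.sup_two (h : IsFlow K a v) (hK : ∀ t, ‖v t‖ ≤ K) {T R : ℝ} (hA : 0 < ‖a‖)
    (hT : T * ‖a‖ ^ 2 ≤ 1 / 16) (hR : ∀ n, ‖a n‖ ≤ R)
    (t : ℝ) (ht : 0 ≤ t) (htT : t ≤ T) (n : ℤ) : ‖v t n‖ ≤ 2 * R := by
  have hR0 : 0 ≤ R := (norm_nonneg _).trans (hR 0)
  have key : ∀ k : ℕ, ∀ t, 0 ≤ t → t ≤ T → ∀ n, ‖v t n‖ ≤ 2 * R + 2 * ‖a‖ * (1 / 2) ^ k := by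
    intro k
    induction k with
    | zero =>
      intro t ht htT n
      have h1 := h.norm_two hK hA hT t ht htT
      have h2 := apply_le (v t) n
      simp
      linarith
    | succ k ih =>
      intro t ht htT n
      have h1 := h.sup_step hK hA hT ih t ht htT n
      have h2 : ‖v t n‖ ≤ ‖a n‖ + ‖v t n - a n‖ := by
        have := norm_add_le (a n) (v t n - a n)
        rwa [add_sub_cancel] at this
      have h3 : t * ‖a‖ ^ 2 ≤ 1 / 16 := le_trans (by gcongr) hT
      have h4 := hR n
      have h5 : 0 ≤ 2 * R + 2 * ‖a‖ * (1 / 2) ^ k := by positivity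
      have h6 : 4 * ‖a‖ ^ 2 * (2 * R + 2 * ‖a‖ * (1 / 2) ^ k) * t ≤
          4 * (1 / 16) * (2 * R + 2 * ‖a‖ * (1 / 2) ^ k) := by
        calc _ = 4 * (t * ‖a‖ ^ 2) * (2 * R + 2 * ‖a‖ * (1 / 2) ^ k) := by ring
          _ ≤ _ := by gcongr
      have h7 : 0 ≤ ‖a‖ * (1 / 2) ^ k := by positivity
      rw [pow_succ]
      linarith
  have hlim : Filter.Tendsto (fun k : ℕ => 2 * R + 2 * ‖a‖ * (1 / 2 : ℝ) ^ k) Filter.atTop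
      (nhds (2 * R + 2 * ‖a‖ * 0)) :=
    ((tendsto_pow_atTop_nhds_zero_of_lt_one (by norm_num) (by norm_num)).const_mul _).const_add _
  rw [mul_zero, add_zero] at hlim
  exact ge_of_tendsto' hlim fun k => key k t ht htT n

end

theorem inflation_core {N : ℕ} (hN : 1 ≤ N) {R T K : ℝ} {v : ℝ → L1} (hR : 0 < R) (hT : 0 < T)
    (h1 : T * (R ^ 2 * N ^ 2) ≤ 1 / 1000000) (h2 : T * N ^ 2 ≤ 1 / 1000000)
    (h : IsFlow K (dat N R) v) (hK : ∀ t, ‖v t‖ ≤ K) {n : ℤ} (h0 : 0 ≤ n) (hn : n < N) :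
    1 / 2 * (R ^ 3 * N ^ 2) * T ≤ ‖v T n‖ := by
  have hN1 : (1 : ℝ) ≤ N := by exact_mod_cast hN
  set A := ‖dat N R‖ with hAdef
  have hA : 0 < A := by
    rw [hAdef, norm_dat hR.le]
    positivity
  have hA5 : A ≤ 5 * (R * N) := by
    rw [hAdef, norm_dat hR.le]
    nlinarith
  have hA2 : A ^ 2 ≤ 25 * (R ^ 2 * N ^ 2) := by
    calc A ^ 2 ≤ (5 * (R * N)) ^ 2 := by gcongr
      _ = _ := by ring
  have hTA : T * A ^ 2 ≤ 25 / 1000000 := by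
    calc T * A ^ 2 ≤ T * (25 * (R ^ 2 * N ^ 2)) := by gcongr
      _ = 25 * (T * (R ^ 2 * N ^ 2)) := by ring
      _ ≤ _ := by linarith
  have hTA' : T * A ^ 2 ≤ 1 / 16 := by linarith
  have hsupa : ∀ n, ‖dat N R n‖ ≤ R := fun n => by
    rw [norm_dat_apply hR.le]
    exact al_le hR.le n
  have hsup := h.sup_two hK hA hTA' hsupa
  have hdiff := h.sup_step hK hA hTA' hsup
  have hc : ∀ t, 0 ≤ t → t ≤ T → ∀ n, ‖S t (v t) n - dat N R n‖ ≤ 1200 / 1000000 * R := by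
    intro t ht htT n
    have e1 : S t (v t) n - dat N R n = ph n t * (v t n - dat N R n) + (ph n t - 1) * dat N R n := by
      rw [S_apply]
      ring
    rw [e1]
    refine (norm_add_le _ _).trans ?_
    rw [norm_mul, norm_mul, norm_ph, one_mul]
    have q1 := hdiff t ht htT n
    have q2 : 4 * A ^ 2 * (2 * R) * t ≤ 200 / 1000000 * R := by
      calc 4 * A ^ 2 * (2 * R) * t ≤ 4 * A ^ 2 * (2 * R) * T := by gcongr
        _ = 8 * R * (T * A ^ 2) := by ring
        _ ≤ 8 * R * (25 / 1000000) := by gcongr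
        _ = _ := by ring
    have q3 : ‖ph n t - 1‖ * ‖dat N R n‖ ≤ 1000 / 1000000 * R := by
      by_cases hmem : n ∈ Finset.Icc (N : ℤ) (5 * N)
      · rw [Finset.mem_Icc] at hmem
        have hn5 : (n : ℝ) ≤ 5 * N := by exact_mod_cast hmem.2
        have hn0 : (0 : ℝ) ≤ n := by
          have : (0 : ℤ) ≤ n := by omega
          exact_mod_cast this
        have q4 : ‖ph n t - 1‖ ≤ 1000 / 1000000 := by
          refine (ph_sub_one n t).trans ?_
          rw [abs_of_nonneg ht]
          calc 40 * (n : ℝ) ^ 2 * t ≤ 40 * (5 * N : ℝ) ^ 2 * T := by gcongr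
            _ = 1000 * (T * N ^ 2) := by ring
            _ ≤ _ := by linarith
        exact mul_le_mul q4 (hsupa n) (norm_nonneg _) (by norm_num)
      · rw [dat_apply, al_of_not_mem R hmem]
        simp
        positivity
    linarith
  have hRN : 0 < R ^ 3 * N ^ 2 := by positivity
  have herr : ∀ τ, 0 ≤ τ → τ ≤ T →
      ‖F K τ (v τ) n - Complex.I * cub (dat N R) n‖ ≤ 1 / 2 * (R ^ 3 * N ^ 2) := by
    intro τ hτ hτT
    have e1 : F K τ (v τ) n - Complex.I * cub (dat N R) n = Complex.I *
        (ph n (-τ) * (cub (S τ (v τ)) n - cub (dat N R) n) + (ph n (-τ) - 1) * cub (dat N R) n) := by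
      rw [F_apply_one h.pos (hK τ)]
      ring
    rw [e1, norm_mul, Complex.norm_I, one_mul]
    refine (norm_add_le _ _).trans ?_
    rw [norm_mul, norm_mul, norm_ph, one_mul]
    have q1 := cub_sub_sup (S τ (v τ)) (dat N R) (2 * A) (1200 / 1000000 * R)
      (by rw [norm_S]; exact h.norm_two hK hA hTA' τ hτ hτT) (by linarith)
      (hc τ hτ hτT) n
    have q2 : 3 * (2 * A) ^ 2 * (1200 / 1000000 * R) ≤ 360000 / 1000000 * (R ^ 3 * N ^ 2) := by
      calc 3 * (2 * A) ^ 2 * (1200 / 1000000 * R) = 14400 / 1000000 * R * A ^ 2 := by ring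
        _ ≤ 14400 / 1000000 * R * (25 * (R ^ 2 * N ^ 2)) := by gcongr
        _ = _ := by ring
    have q3 : ‖ph n (-τ) - 1‖ ≤ 40 / 1000000 := by
      refine (ph_sub_one n (-τ)).trans ?_
      rw [abs_neg, abs_of_nonneg hτ]
      have hn5 : (n : ℝ) ≤ N := by exact_mod_cast hn.le
      have hn0 : (0 : ℝ) ≤ n := by exact_mod_cast h0
      calc 40 * (n : ℝ) ^ 2 * τ ≤ 40 * (N : ℝ) ^ 2 * T := by gcongr
        _ = 40 * (T * N ^ 2) := by ring
        _ ≤ _ := by linarith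
    have q4 : ‖cub (dat N R) n‖ ≤ 25 * (R ^ 3 * N ^ 2) := by
      refine (cub_sup _ R hsupa n).trans ?_
      calc A ^ 2 * R ≤ (25 * (R ^ 2 * N ^ 2)) * R := by gcongr
        _ = _ := by ring
    have q5 := mul_le_mul q3 q4 (norm_nonneg _) (by norm_num)
    linarith
  have hfin := seg (f := fun t : ℝ => v t n - (t : ℂ) * (Complex.I * cub (dat N R) n))
    (f' := fun t => F K t (v t) n - Complex.I * cub (dat N R) n) (C := 1 / 2 * (R ^ 3 * N ^ 2))
    (fun t => by
      have := (apply_der n (h.der t)).sub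
        ((Complex.ofRealCLM.hasDerivAt (x := t)).mul_const (Complex.I * cub (dat N R) n))
      convert! this using 1
      simp) herr hT.le
  have hv0 : v 0 n = 0 := by
    rw [h.start, dat_apply, al_of_not_mem R (by rw [Finset.mem_Icc]; omega)]
    simp
  simp only [hv0, Complex.ofReal_zero, zero_mul, sub_zero] at hfin
  have hlow : R ^ 3 * N ^ 2 * T ≤ ‖(T : ℂ) * (Complex.I * cub (dat N R) n)‖ := by
    rw [norm_mul, norm_mul, Complex.norm_I, one_mul, Complex.norm_real, Real.norm_of_nonneg hT.le,
      mul_comm]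
    gcongr
    exact cub_dat hR.le h0 hn
  have := norm_sub_norm_le ((T : ℂ) * (Complex.I * cub (dat N R) n)) (v T n)
  rw [norm_sub_rev] at this
  linarith

end NLS

namespace NLS

/-! ### Sobolev norms and the conclusion -/

theorem coeff_U (v : ℝ → L1) (t : ℝ) (n : ℤ) :
    fourierCoeff1 (fun x => U (co v) x t) n = co v n t := by
  have := integral_ev_mul (S t (v t)) n
  rw [fourierCoeff1]
  refine Eq.trans ?_ this
  congr 1
  funext x
  rw [U_co, e]
  congr 2
  push_cast
  ring

theorem HsNormT_U (s : ℝ) (v : ℝ → L1) (t : ℝ) :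
    HsNormT s (fun x => U (co v) x t) =
      Real.sqrt (∑' n : ℤ, ((1:ℝ) + (n:ℝ)^2) ^ s * ‖v t n‖^2) := by
  rw [HsNormT]
  simp only [coeff_U, co, S_apply, norm_mul, norm_ph, one_mul]

theorem summable_Hs {s : ℝ} (hs : s ≤ 0) (a : L1) :
    Summable (fun n : ℤ => ((1:ℝ) + (n:ℝ)^2) ^ s * ‖a n‖^2) := by
  refine Summable.of_nonneg_of_le (fun n => by positivity) (fun n => ?_) (summable_sq a)
  refine mul_le_of_le_one_left (by positivity) ?_
  exact Real.rpow_le_one_of_one_le_of_nonpos (by nlinarith [sq_nonneg (n : ℝ)]) hs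

theorem sq_rpow {X : ℝ} (hX : 0 < X) (r : ℝ) : (X ^ r) ^ 2 = (X ^ 2) ^ r := by
  rw [← Real.rpow_natCast, ← Real.rpow_natCast, ← Real.rpow_mul hX.le, ← Real.rpow_mul hX.le,
    mul_comm]

theorem Hs_data {s δ R : ℝ} (hs : s ≤ 0) {N : ℕ} (hN : 1 ≤ N) (hδ : 0 < δ)
    (hR : R = δ * (N : ℝ) ^ (-s - 1 / 2)) :
    ∑' n : ℤ, ((1:ℝ) + (n:ℝ)^2) ^ s * ‖dat N R n‖^2 ≤ 5 * δ ^ 2 := by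
  have hN1 : (1 : ℝ) ≤ N := by exact_mod_cast hN
  have hN0 : (0 : ℝ) < N := by linarith
  have hR0 : 0 ≤ R := by
    rw [hR]
    positivity
  simp only [norm_dat_apply hR0]
  rw [tsum_eq_sum (s := Finset.Icc (N : ℤ) (5 * N)) fun n hn => by simp [al_of_not_mem R hn]]
  have h1 : ∀ n ∈ Finset.Icc (N : ℤ) (5 * N), ((1:ℝ) + (n:ℝ)^2) ^ s * al N R n ^ 2 ≤
      ((N : ℝ) ^ 2) ^ s * R ^ 2 := by
    intro n hn
    rw [Finset.mem_Icc] at hn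
    have hn' : (N : ℝ) ≤ n := by exact_mod_cast hn.1
    have hal := al_le (N := N) hR0 n
    have hal0 := al_nonneg (N := N) hR0 n
    have : ((1:ℝ) + (n:ℝ)^2) ^ s ≤ ((N : ℝ) ^ 2) ^ s := by
      refine Real.rpow_le_rpow_of_nonpos (by positivity) (by nlinarith) hs
    gcongr
  refine (Finset.sum_le_sum h1).trans ?_
  rw [Finset.sum_const, Int.card_Icc, nsmul_eq_mul,
    show (5 * (N : ℤ) + 1 - N).toNat = 4 * N + 1 by omega]
  have h2 : ((N : ℝ) ^ 2) ^ s * R ^ 2 * N = δ ^ 2 := by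
    rw [hR, mul_pow, sq_rpow hN0]
    have : ((N : ℝ) ^ 2) ^ s * ((N : ℝ) ^ 2) ^ (-s - 1 / 2) * N = 1 := by
      rw [← Real.rpow_add (by positivity), show s + (-s - 1 / 2) = -(1 / 2) by ring,
        Real.rpow_neg (by positivity), ← Real.sqrt_eq_rpow, Real.sqrt_sq hN0.le]
      field_simp
    linear_combination δ ^ 2 * this
  have h3 : 0 ≤ ((N : ℝ) ^ 2) ^ s * R ^ 2 := by positivity
  push_cast
  nlinarith

theorem Hs_low {s δ R : ℝ} (hs : s ≤ -(1 / 2)) {N n : ℕ} (hn : n < N) (hδ : 0 < δ)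
    (hR : R = δ * (N : ℝ) ^ (-s - 1 / 2)) :
    δ ^ 2 * (1 / (n + 1)) ≤ ((1:ℝ) + (n:ℝ)^2) ^ s * R ^ 2 := by
  have hn1 : (n : ℝ) + 1 ≤ N := by exact_mod_cast hn
  have hn0 : (0 : ℝ) ≤ n := by positivity
  have hN0 : (0 : ℝ) < N := by linarith
  have hY : (0 : ℝ) < 1 + (n : ℝ) ^ 2 := by positivity
  rw [hR, mul_pow, sq_rpow hN0]
  have h1 : (1 + (n : ℝ) ^ 2) ^ (-s - 1 / 2) ≤ ((N : ℝ) ^ 2) ^ (-s - 1 / 2) := by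
    refine Real.rpow_le_rpow hY.le (by nlinarith) (by linarith)
  have h2 : 1 / ((n : ℝ) + 1) ≤ (1 + (n : ℝ) ^ 2) ^ s * (1 + (n : ℝ) ^ 2) ^ (-s - 1 / 2) := by
    rw [← Real.rpow_add hY, show s + (-s - 1 / 2) = -(1 / 2) by ring,
        Real.rpow_neg (by positivity), ← Real.sqrt_eq_rpow, one_div]
    gcongr
    rw [Real.sqrt_le_left (by positivity)]
    nlinarith
  have h3 : (1 + (n : ℝ) ^ 2) ^ s * (1 + (n : ℝ) ^ 2) ^ (-s - 1 / 2) ≤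
      (1 + (n : ℝ) ^ 2) ^ s * ((N : ℝ) ^ 2) ^ (-s - 1 / 2) := by gcongr
  have h4 := mul_le_mul_of_nonneg_left (h2.trans h3) (sq_nonneg δ)
  linarith

theorem Hs_big {s δ R m : ℝ} (hs : s ≤ -(1 / 2)) {N : ℕ} (hδ : 0 < δ) (hm : 0 ≤ m)
    (hR : R = δ * (N : ℝ) ^ (-s - 1 / 2)) (w : L1)
    (hw : ∀ n : ℤ, 0 ≤ n → n < N → m * R ≤ ‖w n‖) :
    m ^ 2 * δ ^ 2 * ∑ i ∈ Finset.range N, (1 / (i + 1) : ℝ) ≤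
      ∑' n : ℤ, ((1:ℝ) + (n:ℝ)^2) ^ s * ‖w n‖^2 := by
  have hR0 : 0 ≤ R := by
    rw [hR]
    positivity
  have hsum := summable_Hs (by linarith) w (s := s)
  have h1 := hsum.sum_le_tsum ((Finset.range N).map ⟨fun k : ℕ => (k : ℤ), Nat.cast_injective⟩)
    (fun n _ => by positivity)
  refine le_trans ?_ h1
  rw [Finset.sum_map, Finset.mul_sum]
  refine Finset.sum_le_sum fun i hi => ?_
  rw [Finset.mem_range] at hi
  simp only [Function.Embedding.coeFn_mk, Int.cast_natCast]
  have h2 := Hs_low hs hi hδ hR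
  have h3 := hw (i : ℤ) (by positivity) (by exact_mod_cast hi)
  have h4 : (m * R) ^ 2 ≤ ‖w i‖ ^ 2 := by gcongr
  calc m ^ 2 * δ ^ 2 * (1 / ((i : ℝ) + 1)) = m ^ 2 * (δ ^ 2 * (1 / ((i : ℝ) + 1))) := by ring
    _ ≤ m ^ 2 * (((1:ℝ) + (i:ℝ)^2) ^ s * R ^ 2) := by gcongr
    _ = ((1:ℝ) + (i:ℝ)^2) ^ s * (m * R) ^ 2 := by ring
    _ ≤ _ := by gcongr

end NLS

open NLS in
/-- Norm inflation for the defocusing cubic NLS on the circle for `s ≤ −1/2`. -/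
theorem norm_inflation_cubic_NLS_circle (s : ℝ) (hs : s ≤ -(1/2)) (ε : ℝ) (hε : 0 < ε) :
    ∃ (T : ℝ) (u : ℝ → ℝ → ℂ),
      0 < T ∧ T < ε ∧
      ContDiff ℝ (⊤ : ℕ∞) (fun p : ℝ × ℝ => u p.1 p.2) ∧
      (∀ x t : ℝ, u (x + 1) t = u x t) ∧
      (∀ x t : ℝ,
        Complex.I * deriv (fun τ => u x τ) t
          - deriv (deriv fun y => u y t) x
          + (‖u x t‖ : ℂ)^2 * u x t = 0) ∧
      HsNormT s (fun x => u x 0) < ε ∧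
      HsNormT s (fun x => u x T) > ε⁻¹ := by
  set δ : ℝ := min (ε / 10) 1 with hδdef
  have hδ : 0 < δ := by
    rw [hδdef]
    positivity
  have hδ1 : δ ≤ 1 := min_le_right _ _
  have hδε : δ ≤ ε / 10 := min_le_left _ _
  set m : ℝ := 1 / 2 * (δ ^ 2 / 1000000) with hm
  have hm0 : 0 < m := by positivity
  -- choice of the frequency
  obtain ⟨N, hN, hNε, hNbig⟩ : ∃ N : ℕ, 1 ≤ N ∧ ε⁻¹ < N ∧
      ε⁻¹ ^ 2 < m ^ 2 * δ ^ 2 * ∑ i ∈ Finset.range N, (1 / (i + 1) : ℝ) := by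
    have h1 := (Real.tendsto_sum_range_one_div_nat_succ_atTop.const_mul_atTop
      (show 0 < m ^ 2 * δ ^ 2 by positivity)).eventually_gt_atTop (ε⁻¹ ^ 2)
    have h2 := (tendsto_natCast_atTop_atTop (R := ℝ)).eventually_gt_atTop ε⁻¹
    obtain ⟨N, ⟨a1, a2⟩, a3⟩ := ((h1.and h2).and (Filter.eventually_ge_atTop 1)).exists
    exact ⟨N, a3, a2, a1⟩
  have hN1 : (1 : ℝ) ≤ N := by exact_mod_cast hN
  have hN0 : (0 : ℝ) < N := by linarith
  set R : ℝ := δ * (N : ℝ) ^ (-s - 1 / 2) with hR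
  have hRδ : δ ≤ R := by
    rw [hR]
    refine le_mul_of_one_le_right hδ.le (Real.one_le_rpow hN1 (by linarith))
  have hR0 : 0 < R := by linarith
  set T : ℝ := δ ^ 2 / 1000000 / (R ^ 2 * N ^ 2) with hTdef
  have hT : 0 < T := by positivity
  have hT1 : T * (R ^ 2 * N ^ 2) = δ ^ 2 / 1000000 := by
    rw [hTdef]
    field_simp
  have hδ2 : δ ^ 2 ≤ 1 := pow_le_one₀ hδ.le hδ1
  have hT2 : T * N ^ 2 ≤ 1 / 1000000 := by
    have h3 : T * N ^ 2 * R ^ 2 ≤ 1 / 1000000 * R ^ 2 := by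
      have : δ ^ 2 ≤ R ^ 2 := by gcongr
      linarith
    exact le_of_mul_le_mul_right h3 (by positivity)
  obtain ⟨K, v, h, hK⟩ := exists_solution (dat N R) (rapid_dat N R)
  have ha := rapid_dat N R
  refine ⟨T, U (co v), hT, ?_, h.contDiff ha hK, U_periodic _, h.pde ha hK, ?_, ?_⟩
  · have h3 : 1 < N * ε := by
      rw [inv_lt_iff_one_lt_mul₀ hε] at hNε
      linarith
    have h4 : T * N ≤ T * N ^ 2 := by
      have : (N : ℝ) ≤ N ^ 2 := by nlinarith
      gcongr
    by_contra! hcon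
    have h5 : ε * N ≤ T * N := by gcongr
    linarith
  · rw [HsNormT_U, h.start, Real.sqrt_lt' hε]
    refine (Hs_data (by linarith) hN hδ hR).trans_lt ?_
    nlinarith
  · rw [HsNormT_U, gt_iff_lt, Real.lt_sqrt (by positivity)]
    refine hNbig.trans_le (Hs_big hs hδ hm0.le hR (v T) fun n h0 hn => ?_)
    have h6 := inflation_core hN hR0 hT (by rw [hT1]; linarith) hT2 h hK h0 hn
    have h7 : m * R = 1 / 2 * (R ^ 3 * N ^ 2) * T := by
      rw [hm, ← hT1]
      ring
    rw [h7]
    exact h6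
end

section
/- Let s ∈ ℝ and let f ∈ C_c^∞(ℝ) satisfy f̂(ξ) = O(|ξ|^κ) as ξ → 0 for some κ > −s − 1/2, so that ∫_ℝ |ξ|^{2s} |f̂(ξ)|² dξ < ∞. For L ≥ 1 let f_L(x) = Σ_{n∈ℤ} f(x − nL) be the periodization of f with period L. Then ‖f_L‖_{Ḣ^s(𝕋_L)} → ‖f‖_{Ḣ^s(ℝ)} as L → ∞; equivalently, (1/L) Σ_{n∈ℤ, n≠0} |n/L|^{2s} |f̂(n/L)|² → ∫_ℝ |ξ|^{2s} |f̂(ξ)|² dξ as L → ∞, where f̂(ξ) = ∫_ℝ f(x) e^{−2πixξ} dx. -/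
open scoped Real

/-- Fourier coefficient of an `L`-periodic function `f : ℝ → ℂ`:
`f̂(n/L) = (1/L) ∫₀^L f(x) e^{−2πi(n/L)x} dx`. -/
noncomputable def fourierCoeffL (L : ℝ) (f : ℝ → ℂ) (n : ℤ) : ℂ :=
  (1 / (L : ℂ)) *
    ∫ x in (0:ℝ)..L, f x * Complex.exp (-2 * (π : ℂ) * Complex.I * ((n : ℂ) / (L : ℂ)) * (x : ℂ))

/-- Homogeneous Sobolev norm on the scaled torus `𝕋_L`:
`‖f‖_{Ḣ^s(𝕋_L)} = L^{1/2} (Σ_{n∈ℤ, n≠0} |n/L|^{2s} |f̂(n/L)|²)^{1/2}`. -/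
noncomputable def HdotNormL (L s : ℝ) (f : ℝ → ℂ) : ℝ :=
  Real.sqrt (L * ∑' n : ℤ,
    if n = 0 then 0 else |(n:ℝ)/L| ^ (2*s) * ‖fourierCoeffL L f n‖^2)

/-- Periodization of `f` with period `L`: `f_L(x) = Σ_{n∈ℤ} f(x − nL)`. -/
noncomputable def periodization (f : ℝ → ℂ) (L x : ℝ) : ℂ :=
  ∑' n : ℤ, f (x - n * L)

/-- Fourier transform on `ℝ`: `f̂(ξ) = ∫_ℝ f(x) e^{−2πixξ} dx`. -/
noncomputable def fourierInt (f : ℝ → ℂ) (ξ : ℝ) : ℂ :=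
  ∫ x : ℝ, f x * Complex.exp (-2 * (π : ℂ) * Complex.I * (x : ℂ) * (ξ : ℂ))

section helpers

open MeasureTheory Set Filter Topology

lemma aux_ceil_ge {L x : ℝ} (hL : 0 < L) : x ≤ (⌈x * L⌉₊ : ℝ) / L := by
  rw [le_div_iff₀ hL]; exact Nat.le_ceil _

lemma aux_step_integrable {g h : ℝ → ℝ} (hle : ∀ x, 0 < x → |g x| ≤ h x)
    (hanti : AntitoneOn h (Ioi 0)) (hint : IntegrableOn h (Ioi 0)) {L : ℝ} (hL : 0 < L) :
    IntegrableOn (fun x : ℝ => g ((⌈x * L⌉₊ : ℝ) / L)) (Ioi 0) := by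
  refine Integrable.mono' hint ?_ ?_
  · have h1 : Measurable (fun n : ℕ => g ((n : ℝ) / L)) := measurable_from_top
    have h2 : Measurable (fun x : ℝ => ⌈x * L⌉₊) := Nat.measurable_ceil.comp (by fun_prop)
    exact (h1.comp h2).aestronglyMeasurable
  · refine ae_restrict_of_forall_mem measurableSet_Ioi fun x hx => ?_
    have hx0 : (0:ℝ) < x := hx
    have := aux_ceil_ge (x := x) hL
    have hp : 0 < (⌈x * L⌉₊ : ℝ) / L := hx0.trans_le this
    exact (hle _ hp).trans (hanti hx hp this)

lemma aux_hasSum {g h : ℝ → ℝ} (hle : ∀ x, 0 < x → |g x| ≤ h x)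
    (hanti : AntitoneOn h (Ioi 0)) (hint : IntegrableOn h (Ioi 0)) {L : ℝ} (hL : 0 < L) :
    HasSum (fun n : ℕ => (1 / L) * g (((n:ℝ) + 1) / L))
      (∫ x in Ioi 0, g ((⌈x * L⌉₊ : ℝ) / L)) := by
  have hU : (⋃ n : ℕ, Ioc ((n : ℝ) / L) (((n:ℝ) + 1) / L)) = Ioi 0 := by
    ext x
    simp only [mem_iUnion, mem_Ioc, mem_Ioi, div_lt_iff₀ hL, le_div_iff₀ hL]
    constructor
    · rintro ⟨n, h1, -⟩
      have : (0:ℝ) ≤ n := Nat.cast_nonneg n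
      by_contra! hx
      nlinarith
    · intro hx
      have hxL : 0 < x * L := mul_pos hx hL
      have hc : 0 < ⌈x * L⌉₊ := Nat.ceil_pos.2 hxL
      refine ⟨⌈x * L⌉₊ - 1, ?_, ?_⟩
      · have := Nat.ceil_lt_add_one hxL.le
        push_cast [Nat.cast_sub hc]
        linarith
      · rw [Nat.cast_sub (by omega)]
        have := Nat.le_ceil (x * L)
        push_cast
        linarith
  have key := hasSum_integral_iUnion (μ := volume)
    (s := fun n : ℕ => Ioc ((n : ℝ) / L) (((n:ℝ) + 1) / L))
    (f := fun x : ℝ => g ((⌈x * L⌉₊ : ℝ) / L)) (fun _ => measurableSet_Ioc) ?_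
    (by rw [hU]; exact aux_step_integrable hle hanti hint hL)
  · rw [hU] at key
    suffices hfun : ∀ n : ℕ, (1 / L) * g (((n:ℝ) + 1) / L) =
        ∫ x in Ioc ((n : ℝ) / L) (((n:ℝ) + 1) / L), g ((⌈x * L⌉₊ : ℝ) / L) by
      rw [funext hfun]
      exact key
    intro n
    have : ∀ x ∈ Ioc ((n : ℝ) / L) (((n:ℝ) + 1) / L),
        g ((⌈x * L⌉₊ : ℝ) / L) = g (((n:ℝ) + 1) / L) := by
      intro x hx
      rw [mem_Ioc, div_lt_iff₀ hL, le_div_iff₀ hL] at hx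
      have : ⌈x * L⌉₊ = n + 1 := by
        rw [Nat.ceil_eq_iff (by omega)]
        push_cast
        simpa using hx
      rw [this]; push_cast; rfl
    rw [setIntegral_congr_fun measurableSet_Ioc this, setIntegral_const]
    rw [Real.volume_real_Ioc_of_le (by gcongr; linarith)]
    simp only [smul_eq_mul]
    ring
  · intro i j hij
    rw [Function.onFun, Set.disjoint_left]
    intro x hx hy
    rw [mem_Ioc, div_lt_iff₀ hL, le_div_iff₀ hL] at hx hy
    have h1 : (i:ℝ) < j + 1 := by linarith
    have h2 : (j:ℝ) < i + 1 := by linarith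
    norm_cast at h1 h2
    omega

lemma aux_tendsto {g h : ℝ → ℝ} (hg : ContinuousOn g (Ioi 0)) (hle : ∀ x, 0 < x → |g x| ≤ h x)
    (hanti : AntitoneOn h (Ioi 0)) (hint : IntegrableOn h (Ioi 0)) :
    Tendsto (fun L : ℝ => ∫ x in Ioi 0, g ((⌈x * L⌉₊ : ℝ) / L)) atTop
      (𝓝 (∫ x in Ioi 0, g x)) := by
  refine tendsto_integral_filter_of_dominated_convergence h ?_ ?_ hint ?_
  · filter_upwards [eventually_gt_atTop 0] with L hL
    exact (aux_step_integrable hle hanti hint hL).aestronglyMeasurable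
  · filter_upwards [eventually_gt_atTop 0] with L hL
    refine ae_restrict_of_forall_mem measurableSet_Ioi fun x hx => ?_
    have hx0 : (0:ℝ) < x := hx
    have := aux_ceil_ge (x := x) hL
    have hp : 0 < (⌈x * L⌉₊ : ℝ) / L := hx0.trans_le this
    exact (hle _ hp).trans (hanti hx hp this)
  · refine ae_restrict_of_forall_mem measurableSet_Ioi fun x hx => ?_
    have hx0 : (0:ℝ) < x := hx
    exact ((hg.continuousAt (Ioi_mem_nhds hx0)).tendsto).comp
      (tendsto_nat_ceil_mul_div_atTop hx0.le)

lemma aux_h_anti {a C : ℝ} (ha : a ≤ 0) (hC : 0 ≤ C) :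
    AntitoneOn (fun x : ℝ => C * min (x ^ a) (x ^ (-2 : ℝ))) (Ioi 0) := by
  intro x hx y hy hxy
  have hx0 : (0:ℝ) < x := hx
  refine mul_le_mul_of_nonneg_left (min_le_min ?_ ?_) hC
  · exact Real.rpow_le_rpow_of_nonpos hx0 hxy ha
  · exact Real.rpow_le_rpow_of_nonpos hx0 hxy (by norm_num)

lemma aux_h_int {a C : ℝ} (ha : -1 < a) :
    IntegrableOn (fun x : ℝ => C * min (x ^ a) (x ^ (-2 : ℝ))) (Ioi 0) := by
  refine Integrable.const_mul ?_ C
  have hm : Measurable (fun x : ℝ => min (x ^ a) (x ^ (-2 : ℝ))) := by fun_prop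
  change IntegrableOn _ _ _
  rw [← Ioc_union_Ioi_eq_Ioi (zero_le_one (α := ℝ))]
  refine IntegrableOn.union ?_ ?_
  · have h1 : IntegrableOn (fun x : ℝ => x ^ a) (Ioc 0 1) := by
      rw [← intervalIntegrable_iff_integrableOn_Ioc_of_le zero_le_one]
      exact intervalIntegral.intervalIntegrable_rpow' ha
    refine Integrable.mono' h1 hm.aestronglyMeasurable ?_
    refine ae_restrict_of_forall_mem measurableSet_Ioc fun x hx => ?_
    have hx0 : (0:ℝ) < x := hx.1
    rw [Real.norm_of_nonneg (by positivity)]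
    exact min_le_left _ _
  · have h1 : IntegrableOn (fun x : ℝ => x ^ (-2:ℝ)) (Ioi 1) :=
      integrableOn_Ioi_rpow_of_lt (by norm_num) one_pos
    refine Integrable.mono' h1 hm.aestronglyMeasurable ?_
    refine ae_restrict_of_forall_mem measurableSet_Ioi fun x hx => ?_
    have hx0 : (0:ℝ) < x := zero_lt_one.trans hx
    rw [Real.norm_of_nonneg (by positivity)]
    exact min_le_right _ _

lemma aux_rpow_le {δ x p q : ℝ} (hδ : 0 < δ) (hx : δ ≤ x) (hpq : p ≤ q) :
    x ^ p ≤ δ ^ (p - q) * x ^ q := by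
  have hx0 := hδ.trans_le hx
  have : x ^ p = x ^ (p - q) * x ^ q := by rw [← Real.rpow_add hx0]; ring_nf
  rw [this]
  exact mul_le_mul_of_nonneg_right (Real.rpow_le_rpow_of_nonpos hδ hx (by linarith)) (by positivity)

lemma aux_fourier_eq (f : ℝ → ℂ) : fourierInt f = FourierTransform.fourier f := by
  ext ξ
  rw [Real.fourier_real_eq_integral_exp_smul, fourierInt]
  congr 1
  ext x
  rw [smul_eq_mul, mul_comm]
  congr 2
  push_cast
  ring

lemma aux_fourier_cont {f : ℝ → ℂ} (hf : ContDiff ℝ (⊤ : ℕ∞) f) (hsupp : HasCompactSupport f) :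
    Continuous (fourierInt f) := by
  rw [aux_fourier_eq]
  exact (FourierTransform.fourier (hsupp.toSchwartzMap hf)).continuous

lemma aux_fourier_decay {f : ℝ → ℂ} (hf : ContDiff ℝ (⊤ : ℕ∞) f) (hsupp : HasCompactSupport f)
    (N : ℕ) : ∃ C, 0 < C ∧ ∀ x : ℝ, |x| ^ N * ‖fourierInt f x‖ ≤ C := by
  rw [aux_fourier_eq]
  obtain ⟨C, hC, h⟩ := (FourierTransform.fourier (hsupp.toSchwartzMap hf)).decay N 0
  refine ⟨C, hC, fun x => ?_⟩
  have := h x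
  rw [norm_iteratedFDeriv_zero] at this
  exact this

/-- The key bound. -/
lemma aux_bound {s : ℝ} {f : ℝ → ℂ}
    (hf : ContDiff ℝ (⊤ : ℕ∞) f) (hsupp : HasCompactSupport f)
    {κ : ℝ} (hO : Asymptotics.IsBigO (nhds (0:ℝ)) (fun ξ : ℝ => fourierInt f ξ)
      (fun ξ : ℝ => |ξ| ^ κ)) {a : ℝ} (ha : -1 < a) (haκ : a ≤ 2 * s + 2 * κ) :
    ∃ C, 0 ≤ C ∧ ∀ ξ : ℝ, ξ ≠ 0 →
      |ξ| ^ (2 * s) * ‖fourierInt f ξ‖ ^ 2 ≤ C * min (|ξ| ^ a) (|ξ| ^ (-2 : ℝ)) := by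
  obtain ⟨c, hc, hcO⟩ := hO.exists_pos
  obtain ⟨ε, hε, hball⟩ := Metric.eventually_nhds_iff.1 hcO.bound
  set δ := min ε 1 with hδ
  have hδ0 : 0 < δ := lt_min hε one_pos
  obtain ⟨N, hN⟩ := exists_nat_ge (s + 1)
  obtain ⟨D, hD, hdec⟩ := aux_fourier_decay hf hsupp N
  set C := max (c ^ 2) (max (D ^ 2 * δ ^ ((2 * s - 2 * N) - a)) (D ^ 2 * δ ^ ((2 * s - 2 * N) - (-2))))
  have hC1 : c ^ 2 ≤ C := le_max_left _ _
  have hC2 : D ^ 2 * δ ^ ((2 * s - 2 * N) - a) ≤ C := (le_max_left _ _).trans (le_max_right _ _)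
  have hC3 : D ^ 2 * δ ^ ((2 * s - 2 * N) - (-2)) ≤ C := (le_max_right _ _).trans (le_max_right _ _)
  have hC0 : 0 ≤ C := (sq_nonneg c).trans hC1
  refine ⟨C, hC0, fun ξ hξ => ?_⟩
  have hx : 0 < |ξ| := abs_pos.2 hξ
  rw [mul_min_of_nonneg _ _ hC0]
  rcases lt_or_ge |ξ| δ with hlt | hge
  · have h1 : ‖fourierInt f ξ‖ ≤ c * |ξ| ^ κ := by
      have := hball (y := ξ) (by rw [Real.dist_eq, sub_zero]; exact hlt.trans_le (min_le_left _ _))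
      rwa [Real.norm_of_nonneg (by positivity)] at this
    have hx1 : |ξ| ≤ 1 := hlt.le.trans (min_le_right _ _)
    have h2 : |ξ| ^ (2 * s) * ‖fourierInt f ξ‖ ^ 2 ≤ c ^ 2 * |ξ| ^ (2 * s + 2 * κ) := by
      calc _ ≤ |ξ| ^ (2 * s) * (c * |ξ| ^ κ) ^ 2 := by gcongr
        _ = _ := by
          rw [Real.rpow_add hx, show 2 * κ = κ + κ by ring, Real.rpow_add hx]; ring
    refine h2.trans (le_min ?_ ?_)
    · exact mul_le_mul hC1 (Real.rpow_le_rpow_of_exponent_ge hx hx1 haκ) (by positivity) hC0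
    · exact mul_le_mul hC1 (Real.rpow_le_rpow_of_exponent_ge hx hx1 (by linarith)) (by positivity) hC0
  · have h1 : ‖fourierInt f ξ‖ ≤ D * |ξ| ^ (-(N:ℝ)) := by
      rw [Real.rpow_neg hx.le, Real.rpow_natCast, ← div_eq_mul_inv, le_div_iff₀ (by positivity)]
      rw [mul_comm]; exact hdec ξ
    have h2 : |ξ| ^ (2 * s) * ‖fourierInt f ξ‖ ^ 2 ≤ D ^ 2 * |ξ| ^ (2 * s - 2 * N) := by
      calc _ ≤ |ξ| ^ (2 * s) * (D * |ξ| ^ (-(N:ℝ))) ^ 2 := by gcongr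
        _ = _ := by
          rw [show 2 * s - 2 * (N:ℝ) = 2 * s + (-N + -N) by ring, Real.rpow_add hx,
            Real.rpow_add hx]; ring
    refine h2.trans (le_min ?_ ?_)
    · refine le_trans ?_ (mul_le_mul_of_nonneg_right hC2 (by positivity))
      rw [mul_assoc]
      exact mul_le_mul_of_nonneg_left (aux_rpow_le hδ0 hge (by linarith)) (by positivity)
    · refine le_trans ?_ (mul_le_mul_of_nonneg_right hC3 (by positivity))
      rw [mul_assoc]
      exact mul_le_mul_of_nonneg_left (aux_rpow_le hδ0 hge (by linarith)) (by positivity)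

lemma aux_part2 (s : ℝ) (f : ℝ → ℂ)
    (hf : ContDiff ℝ (⊤ : ℕ∞) f) (hsupp : HasCompactSupport f)
    (κ : ℝ) (hκ : -s - 1/2 < κ)
    (hO : Asymptotics.IsBigO (nhds (0:ℝ)) (fun ξ : ℝ => fourierInt f ξ)
      (fun ξ : ℝ => |ξ| ^ κ)) :
    Filter.Tendsto
      (fun L : ℝ => (1/L) * ∑' n : ℤ,
        if n = 0 then 0 else |(n:ℝ)/L| ^ (2*s) * ‖fourierInt f ((n:ℝ)/L)‖^2)
      Filter.atTop
      (nhds (∫ ξ : ℝ, |ξ| ^ (2*s) * ‖fourierInt f ξ‖^2)) := by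
  set a := min 0 (2 * s + 2 * κ) with ha_def
  have ha : -1 < a := lt_min (by norm_num) (by linarith)
  have ha0 : a ≤ 0 := min_le_left _ _
  obtain ⟨C, hC, hb⟩ := aux_bound (s := s) hf hsupp hO ha (min_le_right _ _)
  set G : ℝ → ℝ := fun ξ => |ξ| ^ (2*s) * ‖fourierInt f ξ‖^2 with hG
  set h : ℝ → ℝ := fun x : ℝ => C * min (x ^ a) (x ^ (-2 : ℝ)) with hh
  have hcont : ContinuousOn G {0}ᶜ := by
    refine ContinuousOn.mul ?_ ((aux_fourier_cont hf hsupp).norm.pow 2).continuousOn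
    intro x hx
    exact (continuous_abs.continuousAt.rpow_const (Or.inl (abs_ne_zero.2 hx))).continuousWithinAt
  have hGnn : ∀ x, 0 ≤ G x := fun x => by positivity
  have hanti := aux_h_anti ha0 hC
  have hint := aux_h_int (C := C) ha
  have hle1 : ∀ x, 0 < x → |G x| ≤ h x := fun x hx => by
    rw [abs_of_nonneg (hGnn x)]
    have : G x ≤ h |x| := hb x hx.ne'
    rwa [abs_of_pos hx] at this
  have hle2 : ∀ x, 0 < x → |G (-x)| ≤ h x := fun x hx => by
    rw [abs_of_nonneg (hGnn _)]
    have : G (-x) ≤ h |-x| := hb (-x) (neg_ne_zero.2 hx.ne')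
    rwa [abs_neg, abs_of_pos hx] at this
  have hc1 : ContinuousOn G (Ioi 0) := hcont.mono fun x hx => ne_of_gt hx
  have hc2 : ContinuousOn (fun x => G (-x)) (Ioi 0) :=
    hcont.comp continuous_neg.continuousOn fun x hx => neg_ne_zero.2 (ne_of_gt hx)
  have t1 := aux_tendsto hc1 hle1 hanti hint
  have t2 := aux_tendsto hc2 hle2 hanti hint
  have i1 : IntegrableOn G (Ioi 0) := by
    refine Integrable.mono' hint (hc1.aestronglyMeasurable measurableSet_Ioi) ?_
    exact ae_restrict_of_forall_mem measurableSet_Ioi fun x hx => hle1 x hx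
  have i2 : IntegrableOn (fun x => G (-x)) (Ioi 0) := by
    refine Integrable.mono' hint (hc2.aestronglyMeasurable measurableSet_Ioi) ?_
    exact ae_restrict_of_forall_mem measurableSet_Ioi fun x hx => hle2 x hx
  have i3 : IntegrableOn G (Iic 0) := by
    have := (Measure.measurePreserving_neg (volume : Measure ℝ)).integrableOn_comp_preimage
      (Homeomorph.neg ℝ).measurableEmbedding (f := G) (s := Iio 0)
    rw [integrableOn_Iic_iff_integrableOn_Iio, ← this]
    simpa [Function.comp_def] using i2
  have hI : ∫ ξ, G ξ = (∫ x in Ioi 0, G x) + ∫ x in Ioi 0, G (-x) := by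
    rw [integral_comp_neg_Ioi, neg_zero, add_comm, intervalIntegral.integral_Iic_add_Ioi i3 i1]
  rw [hI]
  refine (t1.add t2).congr' ?_
  filter_upwards [eventually_gt_atTop 0] with L hL
  have s1 := aux_hasSum hle1 hanti hint hL
  have s2 := aux_hasSum hle2 hanti hint hL
  have := HasSum.of_add_one_of_neg_add_one
    (f := fun n : ℤ => (1/L) * (if n = 0 then 0 else G ((n:ℝ)/L)))
    (m := ∫ x in Ioi 0, G ((⌈x * L⌉₊ : ℝ) / L)) (m' := ∫ x in Ioi 0, G (-((⌈x * L⌉₊ : ℝ) / L)))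
    ?_ ?_
  · have h3 := this.tsum_eq
    rw [tsum_mul_left] at h3
    rw [h3]
    simp
  · convert s1 using 2 with n
    rw [if_neg (by omega)]
    push_cast; rfl
  · convert s2 using 2 with n
    rw [if_neg (by omega)]
    push_cast; rw [neg_div]

lemma aux_coeff {f : ℝ → ℂ}
    (hf : ContDiff ℝ (⊤ : ℕ∞) f) (hsupp : HasCompactSupport f) {L : ℝ} (hL : 0 < L) (n : ℤ) :
    fourierCoeffL L (periodization f L) n = (1 / (L : ℂ)) * fourierInt f ((n:ℝ) / L) := by
  have hLc : (L : ℂ) ≠ 0 := by exact_mod_cast hL.ne'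
  set e : ℝ → ℂ := fun x =>
    Complex.exp (-2 * (π : ℂ) * Complex.I * ((n : ℂ) / (L : ℂ)) * (x : ℂ)) with he
  have hecont : Continuous e := by fun_prop
  set H : ℝ → ℂ := fun y => f (L * y) * e (L * y) with hH
  have heper : ∀ (x : ℝ) (k : ℤ), e (x + k * L) = e x := by
    intro x k
    simp only [he]
    rw [Complex.exp_eq_exp_iff_exists_int]
    refine ⟨-(n * k), ?_⟩
    push_cast
    field_simp
    ring
  have hHc : Continuous H := by
    have := hf.continuous
    fun_prop
  have hHs : HasCompactSupport H := by
    have h1 : HasCompactSupport (fun y : ℝ => f (L * y)) :=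
      hsupp.comp_homeomorph (Homeomorph.mulLeft₀ L hL.ne')
    exact h1.mul_right
  have hHi : Integrable H := hHc.integrable_of_hasCompactSupport hHs
  have S1 := hHi.hasSum_intervalIntegral_comp_add_int
  have S2 := hHi.norm.hasSum_intervalIntegral_comp_add_int
  have S3 := hasSum_integral_of_summable_integral_norm
    (μ := volume.restrict (Ioc (0:ℝ) 1)) (F := fun (k : ℤ) (x : ℝ) => H (x + k))
    (fun k => (hHi.comp_add_right (k:ℝ)).restrict) (by
      have := S2.summable
      simpa only [intervalIntegral.integral_of_le zero_le_one] using this)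
  simp only [intervalIntegral.integral_of_le (zero_le_one (α := ℝ))] at S1
  have E := S3.unique S1
  have P : ∀ x : ℝ, ∑' k : ℤ, H (x + k) = periodization f L (L * x) * e (L * x) := by
    intro x
    rw [periodization, ← tsum_mul_right, ← (Equiv.neg ℤ).tsum_eq]
    congr 1
    ext k
    simp only [hH, Equiv.neg_apply]
    have : L * (x + ((-k : ℤ) : ℝ)) = L * x + ((-k : ℤ) : ℝ) * L := by ring
    rw [this, heper]
    congr 2
    push_cast; ring
  simp only [P] at E
  rw [← intervalIntegral.integral_of_le zero_le_one,
    intervalIntegral.integral_comp_mul_left (fun y => periodization f L y * e y) hL.ne',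
    hH, Measure.integral_comp_mul_left (fun y => f y * e y), abs_of_pos (inv_pos.2 hL)] at E
  have E2 := smul_right_injective ℂ (inv_pos.2 hL).ne' E
  rw [mul_zero, mul_one] at E2
  rw [fourierCoeffL, fourierInt]
  congr 1
  refine E2.trans ?_
  congr 1
  ext x
  simp only [he]
  congr 2
  push_cast
  ring

end helpers

/-- For `f ∈ C_c^∞(ℝ)` with `f̂(ξ) = O(|ξ|^κ)` as `ξ → 0` for some `κ > −s−1/2`,
the `Ḣ^s(𝕋_L)` norm of the periodization `f_L` converges to the `Ḣ^s(ℝ)` norm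
of `f` as `L → ∞`; equivalently,
`(1/L) Σ_{n≠0} |n/L|^{2s} |f̂(n/L)|² → ∫_ℝ |ξ|^{2s} |f̂(ξ)|² dξ`. -/
theorem periodization_homogeneous_Hs_norm_tendsto (s : ℝ) (f : ℝ → ℂ)
    (hf : ContDiff ℝ (⊤ : ℕ∞) f) (hsupp : HasCompactSupport f)
    (κ : ℝ) (hκ : -s - 1/2 < κ)
    (hO : Asymptotics.IsBigO (nhds (0:ℝ)) (fun ξ : ℝ => fourierInt f ξ)
      (fun ξ : ℝ => |ξ| ^ κ)) :
    Filter.Tendsto (fun L : ℝ => HdotNormL L s (periodization f L)) Filter.atTop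
      (nhds (Real.sqrt (∫ ξ : ℝ, |ξ| ^ (2*s) * ‖fourierInt f ξ‖^2)))
    ∧
    Filter.Tendsto
      (fun L : ℝ => (1/L) * ∑' n : ℤ,
        if n = 0 then 0 else |(n:ℝ)/L| ^ (2*s) * ‖fourierInt f ((n:ℝ)/L)‖^2)
      Filter.atTop
      (nhds (∫ ξ : ℝ, |ξ| ^ (2*s) * ‖fourierInt f ξ‖^2)) := by
  have P2 := aux_part2 s f hf hsupp κ hκ hO
  refine ⟨?_, P2⟩
  refine ((Real.continuous_sqrt.tendsto _).comp P2).congr' ?_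
  filter_upwards [Filter.eventually_gt_atTop 0] with L hL
  simp only [Function.comp_apply, HdotNormL]
  congr 1
  rw [← tsum_mul_left, ← tsum_mul_left]
  congr 1
  ext n
  split_ifs with hn
  · simp
  · rw [aux_coeff hf hsupp hL, norm_mul, norm_div, norm_one, Complex.norm_real,
      Real.norm_of_nonneg hL.le]
    field_simp
end
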